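/- arXiv:1405.6110 — 7 statements merged into one kernel-verified Lean document; each statement's English description precedes it below -/
import Mathlib

section
/- (q-analog of the Mendelsohn equations) Let D be a t-(v,k,λ)_q subspace design on V, let S be a subspace of V with s = dim(S), and let i ∈ {0,…,t}. Then [k−i choose t−i]_q · ∑_{j=i}^{s} [j choose i]_q · α_j(S) = [s choose i]_q · [v−i choose t−i]_q · λ. (Equivalently, ∑_{j=i}^{s} [j choose i]_q α_j(S) = [s choose i]_q λ_i, where λ_i = λ·[v−i choose t−i]_q/[k−i choose t−i]_q is the number of blocks containing a fixed i-dimensional subspace.) -/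
/-- The Gaussian binomial coefficient `[n choose k]_q`, defined via the
`q`-Pascal recursion `[n+1 choose k+1] = [n choose k] + q^(k+1) * [n choose k+1]`.
It equals `∏_{i=0}^{k−1} (q^{n−i} − 1)/(q^{i+1} − 1)` for `0 ≤ k ≤ n` and
`0` otherwise. -/
def gaussBinom (q : ℕ) : ℕ → ℕ → ℕ
  | _, 0 => 1
  | 0, _ + 1 => 0
  | n + 1, k + 1 => gaussBinom q n k + q ^ (k + 1) * gaussBinom q n (k + 1)

/-- A `t-(v,k,λ)_q` subspace design on a vector space `V` over `F = 𝔽_q`: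
a set `D` of `k`-dimensional subspaces (blocks) of `V` such that every
`t`-dimensional subspace of `V` is contained in exactly `lam` blocks of `D`. -/
def IsSubspaceDesign (F : Type*) [Field F] {V : Type*} [AddCommGroup V] [Module F V]
    (t k lam : ℕ) (D : Set (Submodule F V)) : Prop :=
  (∀ B ∈ D, Module.finrank F B = k) ∧
    ∀ T : Submodule F V, Module.finrank F T = t → {B ∈ D | T ≤ B}.ncard = lam

/-- The `i`-th intersection number `α_i(S)` of a subspace `S` in `D`:
the number of blocks `B ∈ D` with `dim(B ⊓ S) = i`. -/
noncomputable def interNum {F V : Type*} [Field F] [AddCommGroup V] [Module F V]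
    (D : Set (Submodule F V)) (S : Submodule F V) (i : ℕ) : ℕ :=
  {B ∈ D | Module.finrank F ↥(B ⊓ S) = i}.ncard

open Finset in
theorem gaussBinom_mul_prod (q : ℕ) (n k : ℕ) :
    (gaussBinom q n k : ℤ) * ∏ i ∈ range k, ((q : ℤ) ^ k - q ^ i) =
      ∏ i ∈ range k, ((q : ℤ) ^ n - q ^ i) := by
  have shift (a b : ℕ) : ∏ i ∈ range (b + 1), ((q : ℤ) ^ (a + 1) - q ^ i) =
      (q ^ (a + 1) - 1) * (q ^ b * ∏ i ∈ range b, ((q : ℤ) ^ a - q ^ i)) := by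
    have h : ∏ i ∈ range b, ((q : ℤ) ^ (a + 1) - q ^ (i + 1)) =
        q ^ b * ∏ i ∈ range b, ((q : ℤ) ^ a - q ^ i) := by
      rw [← card_range b, ← prod_const, card_range, ← prod_mul_distrib]
      exact prod_congr rfl fun i _ => by ring
    rw [prod_range_succ', h, pow_zero, mul_comm]
  induction n generalizing k with
  | zero =>
    cases k with
    | zero => simp [gaussBinom]
    | succ k => simp [gaussBinom, prod_range_succ']
  | succ n ih =>
    cases k with
    | zero => simp [gaussBinom]
    | succ k =>
      have h₁ := ih k
      have h₂ := ih (k + 1)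
      rw [prod_range_succ (fun i => (q : ℤ) ^ n - q ^ i), shift] at h₂
      rw [shift, shift]
      simp only [gaussBinom, Nat.cast_add, Nat.cast_mul, Nat.cast_pow]
      linear_combination ((q : ℤ) ^ (k + 1) - 1) * q ^ k * h₁ + (q : ℤ) ^ (k + 1) * h₂

theorem gaussBinom_eq_zero_of_lt (q : ℕ) {n k : ℕ} (h : n < k) : gaussBinom q n k = 0 := by
  induction n generalizing k with
  | zero =>
    obtain ⟨k, rfl⟩ := Nat.exists_eq_succ_of_ne_zero h.ne'
    rfl
  | succ n ih =>
    obtain ⟨k, rfl⟩ := Nat.exists_eq_succ_of_ne_zero (Nat.ne_zero_of_lt h)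
    simp [gaussBinom, ih (show n < k by lia), ih (show n < k + 1 by lia)]

section Counting

open Module

variable {F : Type*} [Field F] {V : Type*} [AddCommGroup V] [Module F V]

theorem span_range_subtype_comp_of_linearIndependent [FiniteDimensional F V] {k : ℕ}
    {W : Submodule F V} (hW : finrank F W = k) {s : Fin k → W} (hs : LinearIndependent F s) :
    Submodule.span F (Set.range fun i => (s i : V)) = W := by
  have h := hs.span_eq_top_of_card_eq_finrank' (by simp [hW])
  have h' := congrArg (Submodule.map W.subtype) h
  rwa [Submodule.map_span, ← Set.range_comp, Submodule.map_subtype_top] at h'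

theorem card_linearIndependent_eq_card_mul [Fintype F] [FiniteDimensional F V] (k : ℕ) :
    Nat.card {s : Fin k → V // LinearIndependent F s} =
      Nat.card {W : Submodule F V // finrank F W = k} *
        ∏ i : Fin k, (Fintype.card F ^ k - Fintype.card F ^ i.val) := by
  classical
  have : Finite V := Module.finite_of_finite F
  have : Fintype {W : Submodule F V // finrank F W = k} := Fintype.ofFinite _
  let f : (Σ W : {W : Submodule F V // finrank F W = k},
      {s : Fin k → W.1 // LinearIndependent F s}) →
      {s : Fin k → V // LinearIndependent F s} :=
    fun x => ⟨fun i => (x.2.1 i : V), x.2.2.map' x.1.1.subtype (Submodule.ker_subtype _)⟩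
  have hf : Function.Bijective f := by
    constructor
    · rintro ⟨⟨W, hW⟩, s, hs⟩ ⟨⟨W', hW'⟩, s', hs'⟩ h
      have h' : (fun i => (s i : V)) = fun i => (s' i : V) := congrArg Subtype.val h
      obtain rfl : W = W' := by
        rw [← span_range_subtype_comp_of_linearIndependent hW hs, h',
          span_range_subtype_comp_of_linearIndependent hW' hs']
      obtain rfl : s = s' := funext fun i => Subtype.ext (congrFun h' i)
      rfl
    · rintro ⟨s, hs⟩
      refine ⟨⟨⟨Submodule.span F (Set.range s), by simp [finrank_span_eq_card hs]⟩,
        fun i => ⟨s i, Submodule.subset_span ⟨i, rfl⟩⟩, linearIndependent_span hs⟩, rfl⟩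
  rw [← Nat.card_congr (Equiv.ofBijective f hf), Nat.card_sigma, Finset.sum_congr rfl
    fun W _ => (card_linearIndependent W.2.ge).trans (by rw [W.2])]
  simp [Nat.card_eq_fintype_card]

/-- A space of dimension `n` has `[n choose k]_q` subspaces of dimension `k`. -/
theorem card_submodule_finrank_eq [Fintype F] [FiniteDimensional F V] (k : ℕ) :
    Nat.card {W : Submodule F V // finrank F W = k} =
      gaussBinom (Fintype.card F) (finrank F V) k := by
  have : Finite V := Module.finite_of_finite F
  rcases lt_or_ge (finrank F V) k with h | h
  · have : IsEmpty {W : Submodule F V // finrank F W = k} :=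
      ⟨fun W => absurd W.1.finrank_le (by lia)⟩
    rw [gaussBinom_eq_zero_of_lt _ h, Nat.card_of_isEmpty]
  · have hq : 1 < Fintype.card F := Fintype.one_lt_card
    have cast (n : ℕ) (hn : k ≤ n) :
        ((∏ i : Fin k, (Fintype.card F ^ n - Fintype.card F ^ i.val) : ℕ) : ℤ) =
          ∏ i ∈ Finset.range k, ((Fintype.card F : ℤ) ^ n - (Fintype.card F : ℤ) ^ i) := by
      rw [Fin.prod_univ_eq_prod_range (fun i => Fintype.card F ^ n - Fintype.card F ^ i),
        Nat.cast_prod]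
      refine Finset.prod_congr rfl fun i hi => ?_
      rw [Nat.cast_sub (Nat.pow_le_pow_right hq.le ((Finset.mem_range.1 hi).le.trans hn))]
      push_cast
      rfl
    have key := (card_linearIndependent_eq_card_mul (F := F) (V := V) k).symm.trans
      (card_linearIndependent h)
    have hz := congrArg (Nat.cast : ℕ → ℤ) key
    rw [Nat.cast_mul, cast _ le_rfl, cast _ h, ← gaussBinom_mul_prod _ (finrank F V)] at hz
    refine Nat.cast_injective (R := ℤ) (mul_right_cancel₀ ?_ hz)
    refine Finset.prod_ne_zero_iff.2 fun i hi => sub_ne_zero.2 ?_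
    exact_mod_cast (Nat.pow_lt_pow_right hq (Finset.mem_range.1 hi)).ne'

theorem card_submodule_le_finrank_eq [Fintype F] [FiniteDimensional F V] (S : Submodule F V)
    (k : ℕ) :
    Nat.card {W : Submodule F V // W ≤ S ∧ finrank F W = k} =
      gaussBinom (Fintype.card F) (finrank F S) k := by
  rw [← card_submodule_finrank_eq]
  exact Nat.card_congr <| ((S.mapIic.toEquiv.subtypeEquiv
    (q := fun W : Set.Iic S => finrank F W.1 = k) fun W => by
      change _ ↔ finrank F (W.map S.subtype) = k
      rw [Submodule.finrank_map_subtype_eq]).trans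
    (Equiv.subtypeSubtypeEquivSubtypeInter (· ∈ Set.Iic S) (finrank F · = k))).symm

theorem finrank_comap_mkQ [FiniteDimensional F V] (I : Submodule F V) (W : Submodule F (V ⧸ I)) :
    finrank F (W.comap I.mkQ) = finrank F W + finrank F I := by
  let f : W.comap I.mkQ →ₗ[F] W := I.mkQ.restrict fun _ h => h
  have hf : Function.Surjective f := by
    rintro ⟨w, hw⟩
    obtain ⟨x, rfl⟩ := I.mkQ_surjective w
    exact ⟨⟨x, hw⟩, rfl⟩
  have hker : LinearMap.ker f = I.comap (W.comap I.mkQ).subtype := by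
    ext x
    simp [f, ← Subtype.coe_inj]
  have h := f.finrank_range_add_finrank_ker
  rw [LinearMap.range_eq_top.2 hf, finrank_top, hker,
    (Submodule.comapSubtypeEquivOfLe (I.le_comap_mkQ W)).finrank_eq] at h
  exact h.symm

theorem card_submodule_ge_finrank_eq [Fintype F] [FiniteDimensional F V] (I : Submodule F V)
    {k : ℕ} (hk : finrank F I ≤ k) :
    Nat.card {W : Submodule F V // I ≤ W ∧ finrank F W = k} =
      gaussBinom (Fintype.card F) (finrank F V - finrank F I) (k - finrank F I) := by
  rw [← Submodule.finrank_quotient, ← card_submodule_finrank_eq]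
  exact Nat.card_congr <| (((Submodule.comapMkQRelIso I).toEquiv.subtypeEquiv
    (q := fun W : Set.Ici I => finrank F W.1 = k) fun W => by
      change _ ↔ finrank F (W.comap I.mkQ) = k
      rw [finrank_comap_mkQ]
      lia).trans
    (Equiv.subtypeSubtypeEquivSubtypeInter (· ∈ Set.Ici I) (finrank F · = k))).symm

theorem card_submodule_ge_le_finrank_eq [Fintype F] [FiniteDimensional F V]
    {I B : Submodule F V} (hIB : I ≤ B) {k : ℕ} (hk : finrank F I ≤ k) :
    Nat.card {W : Submodule F V // (I ≤ W ∧ W ≤ B) ∧ finrank F W = k} =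
      gaussBinom (Fintype.card F) (finrank F B - finrank F I) (k - finrank F I) := by
  have hI : finrank F (I.comap B.subtype) = finrank F I :=
    (Submodule.comapSubtypeEquivOfLe hIB).finrank_eq
  rw [← hI, ← card_submodule_ge_finrank_eq _ (hI.trans_le hk)]
  refine Nat.card_congr <| (((B.mapIic.toEquiv.subtypeEquiv
    (q := fun W : Set.Iic B => I ≤ W.1 ∧ finrank F W.1 = k) fun W => ?_).trans
    (Equiv.subtypeSubtypeEquivSubtypeInter (· ∈ Set.Iic B)
      fun W => I ≤ W ∧ finrank F W = k)).trans
    (Equiv.subtypeEquivRight fun W => ?_)).symm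
  · have h : I ≤ W.map B.subtype ↔ I.comap B.subtype ≤ W := by
      rw [← Submodule.map_le_map_iff_of_injective B.subtype_injective,
        Submodule.map_comap_subtype, inf_eq_right.2 hIB]
    change _ ↔ I ≤ W.map B.subtype ∧ finrank F (W.map B.subtype) = k
    rw [Submodule.finrank_map_subtype_eq, h]
  · rw [Set.mem_Iic]
    tauto

open Finset in
/-- The number of blocks of a subspace design through a fixed `i`-dimensional subspace. -/
theorem IsSubspaceDesign.gaussBinom_mul_ncard_le [Fintype F] [FiniteDimensional F V]
    {t k lam : ℕ} {D : Set (Submodule F V)} (hD : IsSubspaceDesign F t k lam D)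
    {I : Submodule F V} (hI : finrank F I ≤ t) :
    gaussBinom (Fintype.card F) (k - finrank F I) (t - finrank F I) * {B ∈ D | I ≤ B}.ncard =
      gaussBinom (Fintype.card F) (finrank F V - finrank F I) (t - finrank F I) * lam := by
  classical
  have : Finite V := Module.finite_of_finite F
  have : Fintype (Submodule F V) := Fintype.ofFinite _
  have key := sum_card_bipartiteAbove_eq_sum_card_bipartiteBelow
    (s := {B : Submodule F V | B ∈ D ∧ I ≤ B})
    (t := {T : Submodule F V | I ≤ T ∧ finrank F T = t}) (fun B T => T ≤ B)
  rw [sum_congr rfl (g := fun _ => gaussBinom (Fintype.card F) (k - finrank F I)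
      (t - finrank F I)), sum_congr (s₁ := {T : Submodule F V | I ≤ T ∧ finrank F T = t}) rfl
      (g := fun _ => lam), sum_const, sum_const,
    smul_eq_mul, smul_eq_mul, ← Fintype.card_subtype (fun T => I ≤ T ∧ finrank F T = t),
    ← Nat.card_eq_fintype_card (α := {T : Submodule F V // _}),
    card_submodule_ge_finrank_eq I hI] at key
  · rw [← key, mul_comm, Set.ncard_eq_toFinset_card', Set.toFinset_ofPred]
  · intro T hT
    obtain ⟨hIT, hT⟩ := (mem_filter.1 hT).2
    rw [← hD.2 T hT, Set.ncard_eq_toFinset_card', Set.toFinset_ofPred, bipartiteBelow,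
      filter_filter]
    congr 1
    ext B
    simp only [mem_filter, mem_univ, true_and]
    exact ⟨fun h => ⟨h.1.1, h.2⟩, fun h => ⟨⟨h.1, hIT.trans h.2⟩, h.2⟩⟩
  · intro B hB
    obtain ⟨hB, hIB⟩ := (mem_filter.1 hB).2
    rw [← hD.1 B hB, ← card_submodule_ge_le_finrank_eq hIB hI, Nat.card_eq_fintype_card,
      Fintype.card_subtype, bipartiteAbove, filter_filter]
    congr 1
    ext T
    simp only [mem_filter, mem_univ, true_and]
    tauto

open Finset in
theorem sum_gaussBinom_mul_interNum [Fintype F] [FiniteDimensional F V]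
    (D : Set (Submodule F V)) (S : Submodule F V) (i : ℕ) [Fintype (Submodule F V)]
    [DecidablePred fun I : Submodule F V => I ≤ S ∧ finrank F I = i] :
    ∑ j ∈ Icc i (finrank F S), gaussBinom (Fintype.card F) j i * interNum D S j =
      ∑ I : Submodule F V with I ≤ S ∧ finrank F I = i, {B ∈ D | I ≤ B}.ncard := by
  classical
  have key := sum_card_bipartiteAbove_eq_sum_card_bipartiteBelow
    (s := {B : Submodule F V | B ∈ D})
    (t := {I : Submodule F V | I ≤ S ∧ finrank F I = i}) (fun B I => I ≤ B)
  rw [sum_congr rfl (g := fun I : Submodule F V => {B ∈ D | I ≤ B}.ncard)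
    (s₁ := {I : Submodule F V | I ≤ S ∧ finrank F I = i})] at key
  · rw [← key]
    have h (B : Submodule F V) :
        #(bipartiteAbove (fun B I => I ≤ B) {I : Submodule F V | I ≤ S ∧ finrank F I = i} B) =
          gaussBinom (Fintype.card F) (finrank F ↥(B ⊓ S)) i := by
      rw [← card_submodule_le_finrank_eq, Nat.card_eq_fintype_card, Fintype.card_subtype,
        bipartiteAbove, filter_filter]
      congr 1
      ext I
      simp only [mem_filter, mem_univ, true_and, le_inf_iff]
      tauto
    have hmaps : ∀ B ∈ ({B : Submodule F V | B ∈ D} : Finset _),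
        finrank F ↥(B ⊓ S) ∈ range (finrank F S + 1) := fun B _ =>
      mem_range_succ_iff.2 (Submodule.finrank_mono inf_le_right)
    simp_rw [h]
    rw [← sum_fiberwise_of_maps_to hmaps]
    refine (sum_subset (fun j hj => mem_range_succ_iff.2 (mem_Icc.1 hj).2) ?_).trans
      (sum_congr rfl fun j _ => ?_)
    · intro j hj hj'
      rw [gaussBinom_eq_zero_of_lt, zero_mul]
      simp only [mem_range, mem_Icc] at hj hj'
      lia
    · rw [sum_congr rfl (g := fun _ => gaussBinom (Fintype.card F) j i) fun B hB => by
        rw [(mem_filter.1 hB).2], sum_const, smul_eq_mul, mul_comm, interNum,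
        Set.ncard_eq_toFinset_card', Set.toFinset_ofPred, filter_filter]
  · intro I _
    rw [Set.ncard_eq_toFinset_card', Set.toFinset_ofPred, bipartiteBelow, filter_filter]

end Counting

/-- The `q`-analog of the Mendelsohn equations: for `i ∈ {0,…,t}`,
`[k−i choose t−i]_q · ∑_{j=i}^{s} [j choose i]_q · α_j(S)
  = [s choose i]_q · [v−i choose t−i]_q · λ`. -/
theorem q_mendelsohn_equations {q v t k lam s i : ℕ} (hq : IsPrimePow q)
    {F : Type*} [Field F] [Fintype F] (hF : Fintype.card F = q)
    {V : Type*} [AddCommGroup V] [Module F V] [FiniteDimensional F V]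
    (hV : Module.finrank F V = v)
    {D : Set (Submodule F V)} (hD : IsSubspaceDesign F t k lam D)
    (S : Submodule F V) (hS : Module.finrank F S = s)
    (hit : i ≤ t) :
    gaussBinom q (k - i) (t - i) *
        ∑ j ∈ Finset.Icc i s, gaussBinom q j i * interNum D S j =
      gaussBinom q s i * gaussBinom q (v - i) (t - i) * lam := by
  classical
  have : Finite V := Module.finite_of_finite F
  have : Fintype (Submodule F V) := Fintype.ofFinite _
  subst hF hV hS
  rw [sum_gaussBinom_mul_interNum, Finset.mul_sum, Finset.sum_congr rfl (g := fun _ =>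
      gaussBinom (Fintype.card F) (Module.finrank F V - i) (t - i) * lam),
    Finset.sum_const, smul_eq_mul, ← mul_assoc, ← Fintype.card_subtype,
    ← Nat.card_eq_fintype_card (α := {I : Submodule F V // _}), card_submodule_le_finrank_eq]
  intro I hI
  obtain ⟨-, rfl⟩ := (Finset.mem_filter.1 hI).2
  exact hD.gaussBinom_mul_ncard_le hit
end

section
/- Let q be a prime power. If there exists a 2-(7,3,1)_q subspace design (a q-analog of the Fano plane), then there exists a 2-(7,3,q⁴)_q subspace design. -/
namespace SubspaceDesign

open Module Finset

section Counting

variable {F V : Type*} [Field F] [AddCommGroup V] [Module F V]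

lemma finrank_sup_span_singleton [FiniteDimensional F V] {T : Submodule F V} {v : V} (hv : v ∉ T) :
    finrank F ↥(T ⊔ F ∙ v) = finrank F T + 1 := by
  have h := Submodule.finrank_sup_add_finrank_inf_eq T (F ∙ v)
  have hv0 : v ≠ 0 := fun h0 => hv (h0 ▸ T.zero_mem)
  have hd : T ⊓ F ∙ v = ⊥ :=
    disjoint_iff.mp ((Submodule.disjoint_span_singleton' hv0).mpr hv)
  rw [hd, finrank_bot, finrank_span_singleton hv0] at h
  omega

variable [Fintype F] [Fintype V]

open Classical in
/-- Weighted double counting of the incidences between the vectors of `K` and a family of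
subspaces. -/
lemma sum_mul_card_inf (S : Finset (Submodule F V)) (K : Submodule F V)
    (f : Submodule F V → ℤ) :
    ∑ B ∈ S, f B * (Fintype.card F : ℤ) ^ finrank F ↥(B ⊓ K) =
      ∑ v with v ∈ K, ∑ B ∈ S with v ∈ B, f B := by
  simp_rw [Finset.sum_filter]
  rw [← Finset.sum_filter, Finset.sum_comm]
  refine Finset.sum_congr rfl fun B _ => ?_
  rw [← Finset.sum_filter, Finset.sum_const, nsmul_eq_mul, mul_comm, Finset.filter_filter]
  congr 1
  have h := Module.card_eq_pow_finrank (K := F) (V := ↥(B ⊓ K))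
  rw [← Nat.cast_pow, ← h, Fintype.card_subtype]
  simp only [Submodule.mem_inf, and_comm]

open Classical in
lemma card_filter_mem (K : Submodule F V) :
    (#{v | v ∈ K} : ℤ) = (Fintype.card F : ℤ) ^ finrank F K := by
  have h := Module.card_eq_pow_finrank (K := F) (V := K)
  rw [← Nat.cast_pow, ← h, Fintype.card_subtype]

open Classical in
lemma sum_mem_eq {T K : Submodule F V} (hTK : T ≤ K) (g : V → ℤ) {a c : ℤ}
    (ha : ∀ v ∈ T, g v = a) (hc : ∀ v ∈ K, v ∉ T → g v = c) :
    ∑ v with v ∈ K, g v = (Fintype.card F : ℤ) ^ finrank F T * a +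
      ((Fintype.card F : ℤ) ^ finrank F K - (Fintype.card F : ℤ) ^ finrank F T) * c := by
  have h : ∀ v ∈ (univ.filter (· ∈ K) : Finset V),
      g v = c + if v ∈ T then a - c else 0 := by
    intro v hv
    by_cases hvT : v ∈ T
    · simp [hvT, ha v hvT]
    · simp [hvT, hc v (by simpa using hv) hvT]
  rw [Finset.sum_congr rfl h, Finset.sum_add_distrib, ← Finset.sum_filter, Finset.filter_filter,
    Finset.sum_const, Finset.sum_const, nsmul_eq_mul, nsmul_eq_mul, card_filter_mem]
  have : (univ.filter fun v => v ∈ K ∧ v ∈ T) = (univ.filter (· ∈ T) : Finset V) := by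
    ext v
    simpa using fun h => hTK h
  rw [this, card_filter_mem]
  ring

open Classical in
/-- If the members of `S` contain `T` and partition the vectors of `K` outside `T`, then the
sizes of their traces on `K` are determined by their number. -/
lemma sum_card_inf_of_partition {S : Finset (Submodule F V)} {T K : Submodule F V}
    (hTK : T ≤ K) (hT : ∀ B ∈ S, T ≤ B)
    (hS : ∀ v ∈ K, v ∉ T → #{B ∈ S | v ∈ B} = 1) :
    ∑ B ∈ S, (Fintype.card F : ℤ) ^ finrank F ↥(B ⊓ K) =
      (Fintype.card F : ℤ) ^ finrank F T * #S +
      ((Fintype.card F : ℤ) ^ finrank F K - (Fintype.card F : ℤ) ^ finrank F T) := by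
  have h := sum_mul_card_inf S K fun _ => 1
  simp only [one_mul, Finset.sum_const, nsmul_eq_mul, mul_one] at h
  rw [h, sum_mem_eq (a := #S) (c := 1) hTK, mul_one]
  · intro v hv
    rw [Finset.filter_true_of_mem fun B hB => hT B hB hv]
  · intro v hv hvT
    rw [hS v hv hvT, Nat.cast_one]

open Classical in
/-- The number of subspaces of dimension `finrank T + 1` between `T` and `K`. -/
lemma card_covers {T K : Submodule F V} (hTK : T ≤ K) :
    (#{B : Submodule F V | finrank F B = finrank F T + 1 ∧ T ≤ B ∧ B ≤ K} : ℤ) *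
      ((Fintype.card F : ℤ) ^ (finrank F T + 1) - (Fintype.card F : ℤ) ^ finrank F T) =
      (Fintype.card F : ℤ) ^ finrank F K - (Fintype.card F : ℤ) ^ finrank F T := by
  set S : Finset (Submodule F V) := {B | finrank F B = finrank F T + 1 ∧ T ≤ B ∧ B ≤ K} with hS
  have hmem : ∀ B ∈ S, finrank F B = finrank F T + 1 ∧ T ≤ B ∧ B ≤ K := by simp [hS]
  have h := sum_card_inf_of_partition (S := S) hTK (fun B hB => (hmem B hB).2.1) (by
    intro v hv hvT
    refine Finset.card_eq_one.mpr ⟨T ⊔ F ∙ v, ?_⟩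
    ext B
    simp only [hS, Finset.mem_filter, Finset.mem_univ, true_and, Finset.mem_singleton]
    constructor
    · rintro ⟨⟨h1, h2, -⟩, h4⟩
      refine (Submodule.eq_of_le_of_finrank_eq (sup_le h2 ?_) ?_).symm
      · rwa [Submodule.span_singleton_le_iff_mem]
      · rw [h1, finrank_sup_span_singleton hvT]
    · rintro rfl
      refine ⟨⟨finrank_sup_span_singleton hvT, le_sup_left, sup_le hTK ?_⟩,
        Submodule.mem_sup_right (Submodule.mem_span_singleton_self v)⟩
      rwa [Submodule.span_singleton_le_iff_mem])
  rw [Finset.sum_congr rfl fun B hB => by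
    rw [inf_eq_left.mpr (hmem B hB).2.2, (hmem B hB).1]] at h
  rw [Finset.sum_const, nsmul_eq_mul] at h
  linear_combination h

end Counting

section Fano

variable {F V : Type*} [Field F] [AddCommGroup V] [Module F V]
  {D : Set (Submodule F V)}

lemma block_unique (hD : IsSubspaceDesign F 2 3 1 D) {A A' : Submodule F V}
    (hA : A ∈ D) (hA' : A' ∈ D) (h : 2 ≤ finrank F ↥(A ⊓ A')) : A = A' := by
  obtain ⟨f, hf⟩ := exists_linearIndependent_of_le_finrank h
  obtain ⟨T, hT, hT2⟩ : ∃ T ≤ A ⊓ A', finrank F T = 2 :=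
    ⟨_, Submodule.map_subtype_le _ (Submodule.span F (Set.range f)), by
      rw [Submodule.finrank_map_subtype_eq, finrank_span_eq_card hf, Fintype.card_fin]⟩
  obtain ⟨C, hC⟩ := Set.ncard_eq_one.mp (hD.2 T hT2)
  have h1 : A ∈ ({C} : Set _) := hC ▸ ⟨hA, hT.trans inf_le_left⟩
  have h2 : A' ∈ ({C} : Set _) := hC ▸ ⟨hA', hT.trans inf_le_right⟩
  exact h1.trans h2.symm

variable [FiniteDimensional F V] [Fintype V]

open Classical in
lemma card_blocks_through_pair (hD : IsSubspaceDesign F 2 3 1 D) {u v : V} (hu : u ≠ 0)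
    (hv : v ∉ F ∙ u) : #{B ∈ ({B | B ∈ D ∧ u ∈ B} : Finset (Submodule F V)) | v ∈ B} = 1 := by
  have h := hD.2 (F ∙ u ⊔ F ∙ v)
    (by rw [finrank_sup_span_singleton hv, finrank_span_singleton hu])
  rw [← h, ← Set.ncard_coe_finset]
  congr 1
  ext B
  simp [and_assoc]

open Classical in
/-- The number of blocks in a `5`-dimensional subspace. -/
lemma card_blocks_le [Fintype F] (hV : finrank F V = 7) (hD : IsSubspaceDesign F 2 3 1 D)
    {W : Submodule F V} (hW : finrank F W = 5) :
    (#{B : Submodule F V | B ∈ D ∧ B ≤ W} : ℤ) = (Fintype.card F : ℤ) ^ 2 + 1 := by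
  have hq1 : (1 : ℤ) < Fintype.card F := by exact_mod_cast Fintype.one_lt_card
  have hsum1 : ∀ u ≠ (0 : V), ∀ K : Submodule F V, u ∈ K →
      ∑ B : Submodule F V with B ∈ D ∧ u ∈ B, (Fintype.card F : ℤ) ^ finrank F ↥(B ⊓ K) =
      (Fintype.card F : ℤ) * #{B : Submodule F V | B ∈ D ∧ u ∈ B} +
      ((Fintype.card F : ℤ) ^ finrank F K - (Fintype.card F : ℤ)) := by
    intro u hu K hK
    have := sum_card_inf_of_partition (S := ({B | B ∈ D ∧ u ∈ B} : Finset (Submodule F V)))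
      (T := F ∙ u) (K := K)
      (by rwa [Submodule.span_singleton_le_iff_mem])
      (by simp [Submodule.span_singleton_le_iff_mem])
      (fun v _ hv => card_blocks_through_pair hD hu hv)
    rwa [finrank_span_singleton hu, pow_one] at this
  set q : ℤ := (Fintype.card F : ℤ) with hq
  -- `r` is the number of blocks through a point
  obtain ⟨r, hr, hrq⟩ : ∃ r : ℤ, (∀ u ≠ (0 : V), (#{B : Submodule F V | B ∈ D ∧ u ∈ B} : ℤ) = r) ∧
      r * (q ^ 3 - q) = q ^ 7 - q := by
    have key : ∀ u ≠ (0 : V),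
        (#{B : Submodule F V | B ∈ D ∧ u ∈ B} : ℤ) * (q ^ 3 - q) = q ^ 7 - q := by
      intro u hu
      have h := hsum1 u hu ⊤ trivial
      rw [Finset.sum_congr rfl fun B hB => by
        rw [inf_top_eq, hD.1 B (by simp at hB; exact hB.1)], finrank_top, hV] at h
      rw [Finset.sum_const, nsmul_eq_mul] at h
      linear_combination h
    have hnt : Nontrivial V := Module.nontrivial_of_finrank_pos (R := F) (by omega)
    obtain ⟨u₀, hu₀⟩ := exists_ne (0 : V)
    refine ⟨_, fun u hu => ?_, key u₀ hu₀⟩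
    have hne : q ^ 3 - q ≠ 0 := by
      have : q ^ 3 - q = q * (q - 1) * (q + 1) := by ring
      rw [this]
      have : 0 < q - 1 := by linarith
      positivity
    exact mul_right_cancel₀ hne ((key u hu).trans (key u₀ hu₀).symm)
  obtain ⟨S, hS⟩ : ∃ S : Finset (Submodule F V), S = univ.filter (· ∈ D) := ⟨_, rfl⟩
  have hfil : ∀ u : V, ({B ∈ S | u ∈ B} : Finset _) =
      ({B | B ∈ D ∧ u ∈ B} : Finset (Submodule F V)) := fun u => by
    rw [hS, Finset.filter_filter]
  have hlin : ∀ K : Submodule F V, ∑ B ∈ S, q ^ finrank F ↥(B ⊓ K) =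
      #S + (q ^ finrank F K - 1) * r := by
    intro K
    have h := sum_mul_card_inf S K fun _ => 1
    simp only [one_mul, Finset.sum_const, nsmul_eq_mul, mul_one] at h
    rw [h, sum_mem_eq (T := ⊥) (a := #S) (c := r) bot_le]
    · simp [hq]
    · intro v hv
      simp [(Submodule.mem_bot F).mp hv]
    · intro v _ hv
      rw [hfil, hr v (by simpa using hv)]
  have hb : (#S : ℤ) * (q ^ 3 - 1) = (q ^ 7 - 1) * r := by
    have h := hlin ⊤
    rw [Finset.sum_congr rfl fun B hB => by
      rw [inf_top_eq, hD.1 B (by simpa [hS] using hB)], finrank_top, hV] at h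
    rw [Finset.sum_const, nsmul_eq_mul] at h
    linear_combination h
  have hl := hlin W
  have hsq : ∑ B ∈ S, q ^ finrank F ↥(B ⊓ W) * q ^ finrank F ↥(B ⊓ W) =
      (#S + (q ^ 5 - 1) * r) + (q ^ 5 - 1) * (q * r + (q ^ 5 - q)) := by
    rw [sum_mul_card_inf S W fun B => q ^ finrank F ↥(B ⊓ W),
      sum_mem_eq (T := ⊥) (a := #S + (q ^ 5 - 1) * r) (c := q * r + (q ^ 5 - q)) bot_le]
    · simp [hq, hW]
    · intro v hv
      simp [(Submodule.mem_bot F).mp hv, hl, hW]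
    · intro v hvW hv
      have hv0 : v ≠ 0 := by simpa using hv
      rw [hfil, hsum1 v hv0 W hvW, hr v hv0, hW]
  rw [hW] at hl
  have hprod : ∑ B ∈ S, (q ^ finrank F ↥(B ⊓ W) - q) * (q ^ finrank F ↥(B ⊓ W) - q ^ 2) =
      #{B : Submodule F V | B ∈ D ∧ B ≤ W} * ((q ^ 3 - q) * (q ^ 3 - q ^ 2)) := by
    rw [← nsmul_eq_mul, ← Finset.sum_const, ← Finset.filter_filter, ← hS, Finset.sum_filter]
    refine Finset.sum_congr rfl fun B hB => ?_
    have hB3 : finrank F B = 3 := hD.1 B (by simpa [hS] using hB)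
    split_ifs with hBW
    · rw [inf_eq_left.mpr hBW, hB3]
    · have h1 := Submodule.finrank_sup_add_finrank_inf_eq B W
      have h2 := Submodule.finrank_le (B ⊔ W)
      have h3 : finrank F ↥(B ⊓ W) < finrank F B :=
        Submodule.finrank_lt_finrank_of_lt (inf_lt_left.mpr hBW)
      have h4 : finrank F ↥(B ⊓ W) = 1 ∨ finrank F ↥(B ⊓ W) = 2 := by omega
      rcases h4 with h4 | h4 <;> rw [h4] <;> ring
  have hexp : ∑ B ∈ S, (q ^ finrank F ↥(B ⊓ W) - q) * (q ^ finrank F ↥(B ⊓ W) - q ^ 2) =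
      ∑ B ∈ S, q ^ finrank F ↥(B ⊓ W) * q ^ finrank F ↥(B ⊓ W) -
        (q + q ^ 2) * ∑ B ∈ S, q ^ finrank F ↥(B ⊓ W) + q ^ 3 * #S := by
    rw [Finset.mul_sum, ← Finset.sum_sub_distrib, mul_comm (q ^ 3), ← nsmul_eq_mul,
      ← Finset.sum_const, ← Finset.sum_add_distrib]
    exact Finset.sum_congr rfl fun B _ => by ring
  rw [hprod, hsq, hl] at hexp
  have hpos : 0 < q - 1 := by linarith
  have hr' : r = q ^ 4 + q ^ 2 + 1 := by
    have : q * (q - 1) * (q + 1) ≠ 0 := by positivity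
    refine mul_right_cancel₀ this ?_
    linear_combination hrq
  have hb' : (#S : ℤ) = (q ^ 6 + q ^ 5 + q ^ 4 + q ^ 3 + q ^ 2 + q + 1) * (q ^ 2 - q + 1) := by
    have : (q - 1) * (q ^ 2 + q + 1) ≠ 0 := by positivity
    refine mul_right_cancel₀ this ?_
    rw [hr'] at hb
    linear_combination hb
  rw [hb', hr'] at hexp
  have : q ^ 3 * (q - 1) ^ 2 * (q + 1) ≠ 0 := by positivity
  refine mul_right_cancel₀ this ?_
  linear_combination hexp

end Fano

/-- A finite-dimensional space has an inclusion-reversing map on subspaces which sends each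
subspace to one of complementary dimension. -/
lemma exists_perp (F V : Type*) [Field F] [AddCommGroup V] [Module F V]
    [FiniteDimensional F V] :
    ∃ perp : Submodule F V → Submodule F V, (∀ A B, A ≤ perp B ↔ B ≤ perp A) ∧
      ∀ A, finrank F (perp A) = finrank F V - finrank F A := by
  let b := Module.finBasis F V
  have hsymm : ∀ x y, b.toDual x y = b.toDual y x := by
    intro x y
    have : b.toDual = b.toDual.flip := by
      refine b.ext fun i => b.ext fun j => ?_
      simp [Module.Basis.toDual_apply, eq_comm]
    exact congrArg (fun f => f x y) this
  have hperp : ∀ A B : Submodule F V, A ≤ (B.map b.toDual).dualCoannihilator →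
      B ≤ (A.map b.toDual).dualCoannihilator := by
    intro A B h x hx
    rw [Submodule.mem_dualCoannihilator]
    rintro _ ⟨a, ha, rfl⟩
    rw [hsymm]
    exact (Submodule.mem_dualCoannihilator _).mp (h ha) _ ⟨x, hx, rfl⟩
  refine ⟨fun B => (B.map b.toDual).dualCoannihilator,
    fun A B => ⟨hperp A B, hperp B A⟩, fun A => ?_⟩
  have h := Subspace.finrank_add_finrank_dualCoannihilator_eq (A.map b.toDual)
  have h2 : finrank F (A.map b.toDual) = finrank F A :=
    (Submodule.equivMapOfInjective _ b.toDual_injective A).finrank_eq.symm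
  change finrank F (A.map b.toDual).dualCoannihilator = _
  omega

end SubspaceDesign

open SubspaceDesign Module Finset in
open Classical in
/-- If `perp` is a duality of subspaces, the duals of the `4`-dimensional subspaces that contain
no block of a `q`-Fano plane form a `2-(7,3,q⁴)_q` design. -/
lemma IsSubspaceDesign.dual_of_blockless {F V : Type*} [Field F] [Fintype F] [AddCommGroup V]
    [Module F V] [FiniteDimensional F V] (hV : finrank F V = 7) {D : Set (Submodule F V)}
    (hD : IsSubspaceDesign F 2 3 1 D) {perp : Submodule F V → Submodule F V}
    (hperp : ∀ A B, A ≤ perp B ↔ B ≤ perp A)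
    (hrank : ∀ A, finrank F (perp A) = finrank F V - finrank F A) :
    IsSubspaceDesign F 2 3 (Fintype.card F ^ 4)
      {B : Submodule F V | finrank F B = 3 ∧ ∀ A ∈ D, ¬ A ≤ perp B} := by
  have hfin : Finite V := Module.finite_of_finite F
  have : Fintype V := Fintype.ofFinite V
  refine ⟨fun B hB => hB.1, fun T hT => ?_⟩
  have hanti : ∀ {A B}, A ≤ B → perp B ≤ perp A := fun {A B} h =>
    (hperp _ _).mp (h.trans ((hperp _ _).mp le_rfl))
  set N : Finset (Submodule F V) := {B | finrank F B = 3 ∧ T ≤ B} with hN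
  set P : Finset (Submodule F V) := {A | A ∈ D ∧ A ≤ perp T} with hP
  let I (A : Submodule F V) : Finset (Submodule F V) :=
    {B | finrank F B = 3 ∧ T ≤ B ∧ B ≤ perp A}
  have hset : {B ∈ {B : Submodule F V | finrank F B = 3 ∧ ∀ A ∈ D, ¬ A ≤ perp B} | T ≤ B} =
      ((N \ P.biUnion I : Finset _) : Set (Submodule F V)) := by
    ext B
    simp only [Set.mem_ofPred_eq, hN, hP, I, Finset.coe_sdiff, Set.mem_sdiff, Finset.mem_coe,
      Finset.mem_filter, Finset.mem_univ, true_and, Finset.mem_biUnion, not_exists, not_and]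
    constructor
    · rintro ⟨⟨h1, h2⟩, h3⟩
      exact ⟨⟨h1, h3⟩, fun A hA _ _ hB => h2 A hA.1 ((hperp _ _).mp hB)⟩
    · rintro ⟨⟨h1, h3⟩, h2⟩
      exact ⟨⟨h1, fun A hA hAB => h2 A ⟨hA, hAB.trans (hanti h3)⟩ h1 h3 ((hperp _ _).mp hAB)⟩, h3⟩
  have hsub : P.biUnion I ⊆ N := by
    intro B
    simp only [Finset.mem_biUnion, hN, I, Finset.mem_filter, Finset.mem_univ, true_and]
    rintro ⟨A, -, h1, h2, -⟩
    exact ⟨h1, h2⟩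
  have hdisj : (P : Set (Submodule F V)).PairwiseDisjoint I := by
    intro A hA A' hA' hne
    refine Finset.disjoint_left.mpr fun B hB hB' => hne ?_
    simp only [I, hP, Finset.coe_filter, Set.mem_ofPred_eq, Finset.mem_filter, Finset.mem_univ,
      true_and] at hA hA' hB hB'
    refine block_unique hD hA.1 hA'.1 ?_
    have h1 := Submodule.finrank_sup_add_finrank_inf_eq A A'
    have h2 : finrank F ↥(A ⊔ A') ≤ finrank F (perp B) :=
      Submodule.finrank_mono (sup_le ((hperp _ _).mp hB.2.2) ((hperp _ _).mp hB'.2.2))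
    rw [hrank, hV, hB.1] at h2
    rw [hD.1 A hA.1, hD.1 A' hA'.1] at h1
    omega
  have hq1 : (1 : ℤ) < Fintype.card F := by exact_mod_cast Fintype.one_lt_card
  have hPc : (#P : ℤ) = (Fintype.card F : ℤ) ^ 2 + 1 :=
    card_blocks_le hV hD (by rw [hrank, hV, hT])
  have hNc := card_covers (F := F) (T := T) (K := ⊤) le_top
  have hIc : ∀ A ∈ P, (#(I A) : ℤ) = (Fintype.card F : ℤ) + 1 := by
    intro A hA
    simp only [hP, Finset.mem_filter, Finset.mem_univ, true_and] at hA
    have h := card_covers (F := F) (T := T) (K := perp A) ((hperp _ _).mp hA.2)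
    rw [hrank, hV, hT, hD.1 A hA.1] at h
    have hpos : (0 : ℤ) < (Fintype.card F : ℤ) - 1 := by linarith
    have h0 : (Fintype.card F : ℤ) ^ 2 * ((Fintype.card F : ℤ) - 1) ≠ 0 := by positivity
    refine mul_right_cancel₀ h0 ?_
    linear_combination h
  rw [hset, Set.ncard_coe_finset]
  have hc : (#(N \ P.biUnion I) : ℤ) = #N - #(P.biUnion I) := by
    rw [Finset.card_sdiff_of_subset hsub, Nat.cast_sub (Finset.card_le_card hsub)]
  rw [Finset.card_biUnion hdisj, Nat.cast_sum, Finset.sum_congr rfl hIc, Finset.sum_const,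
    nsmul_eq_mul, hPc] at hc
  simp only [le_top, and_true, finrank_top, hV, hT, Nat.reduceAdd] at hNc
  rw [← hN] at hNc
  have hpos : (0 : ℤ) < (Fintype.card F : ℤ) - 1 := by linarith
  have h0 : (Fintype.card F : ℤ) ^ 2 * ((Fintype.card F : ℤ) - 1) ≠ 0 := by positivity
  have : (#(N \ P.biUnion I) : ℤ) = (Fintype.card F : ℤ) ^ 4 := by
    refine mul_right_cancel₀ h0 ?_
    linear_combination (Fintype.card F : ℤ) ^ 2 * ((Fintype.card F : ℤ) - 1) * hc + hNc
  exact_mod_cast this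

/-- If a `2-(7,3,1)_q` subspace design (a `q`-analog of the Fano plane) exists,
then a `2-(7,3,q⁴)_q` subspace design exists. -/
theorem fano_implies_q4_design {q : ℕ} (hq : IsPrimePow q)
    {F : Type*} [Field F] [Fintype F] (hF : Fintype.card F = q)
    {V : Type*} [AddCommGroup V] [Module F V] [FiniteDimensional F V]
    (hV : Module.finrank F V = 7)
    (D : Set (Submodule F V)) (hD : IsSubspaceDesign F 2 3 1 D) :
    ∃ D' : Set (Submodule F V), IsSubspaceDesign F 2 3 (q ^ 4) D' := by
  subst hF
  obtain ⟨perp, hperp, hrank⟩ := SubspaceDesign.exists_perp F V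
  exact ⟨_, hD.dual_of_blockless hV hperp hrank⟩
end

section
/- Let q be a prime power, V a 7-dimensional vector space over 𝔽_q, and D a 2-(7,3,1)_q subspace design on V. Then every 5-dimensional subspace S of V contains exactly q² + 1 blocks of D; more precisely, its intersection vector is α_0(S) = 0, α_1(S) = q⁸, α_2(S) = q³(q+1)(q²+1), α_3(S) = q² + 1. -/
open Classical in
/-- The ordered linearly independent pairs `(x, y)` with `x ∈ S` and `y ∈ T`. -/
noncomputable def indepPairs {F V : Type*} [Field F] [AddCommGroup V] [Module F V] [Fintype V]
    (S T : Submodule F V) : Finset (V × V) :=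
  {p | p.1 ∈ S ∧ p.2 ∈ T ∧ p.1 ≠ 0 ∧ p.2 ∉ Submodule.span F {p.1}}

section

variable {F V : Type*} [Field F] [AddCommGroup V] [Module F V]

theorem card_indepPairs [Fintype F] [Fintype V] {S T : Submodule F V} (hST : S ≤ T) :
    ((indepPairs S T).card : ℤ) =
      ((Fintype.card F : ℤ) ^ Module.finrank F S - 1) *
        ((Fintype.card F : ℤ) ^ Module.finrank F T - Fintype.card F) := by
  classical
  have hcard (U : Submodule F V) :
      (Finset.univ.filter (· ∈ U)).card = Fintype.card F ^ Module.finrank F U := by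
    rw [← Module.card_eq_pow_finrank (K := F) (V := U), Fintype.card_subtype]
  have hsigma : (indepPairs S T).card =
      ∑ x ∈ (Finset.univ.filter (· ∈ S)).erase 0,
        (Finset.univ.filter (· ∈ T) \ Finset.univ.filter (· ∈ Submodule.span F {x})).card := by
    rw [← Finset.card_sigma]
    refine Finset.card_bij (fun p _ => ⟨p.1, p.2⟩) ?_ ?_ ?_
    · simp +contextual [indepPairs]
    · rintro ⟨a, b⟩ _ ⟨c, d⟩ _ h
      simpa using h
    · rintro ⟨a, b⟩ h
      refine ⟨(a, b), ?_, rfl⟩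
      simp only [Finset.mem_sigma, Finset.mem_erase, Finset.mem_filter, Finset.mem_univ, true_and,
        Finset.mem_sdiff] at h
      simp only [indepPairs, Finset.mem_filter, Finset.mem_univ, true_and]
      tauto
  have hfiber : ∀ x ∈ (Finset.univ.filter (· ∈ S)).erase 0,
      ((Finset.univ.filter (· ∈ T) \
        Finset.univ.filter (· ∈ Submodule.span F {x})).card : ℤ) =
        (Fintype.card F : ℤ) ^ Module.finrank F T - Fintype.card F := by
    intro x hx
    simp only [Finset.mem_erase, Finset.mem_filter, Finset.mem_univ, true_and] at hx
    have hle : Submodule.span F {x} ≤ T := by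
      simpa using hST hx.2
    rw [Finset.cast_card_sdiff (fun y hy => by simpa using hle (by simpa using hy)), hcard, hcard,
      finrank_span_singleton hx.1]
    simp
  have hzero : (0 : V) ∈ Finset.univ.filter (· ∈ S) := by simp
  rw [hsigma, Nat.cast_sum, Finset.sum_congr rfl hfiber, Finset.sum_const, nsmul_eq_mul,
    Finset.cast_card_erase_of_mem hzero, hcard]
  simp

theorem finrank_span_pair_eq_two {x y : V} (hx : x ≠ 0) (hy : y ∉ Submodule.span F {x}) :
    Module.finrank F (Submodule.span F {x, y}) = 2 := by
  have hli : LinearIndependent F ![x, y] := by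
    rw [LinearIndependent.pair_iff' hx]
    exact fun a ha => hy (Submodule.mem_span_singleton.2 ⟨a, ha⟩)
  rw [← Matrix.range_cons_cons_empty x y ![], finrank_span_eq_card hli, Fintype.card_fin]

theorem IsSubspaceDesign.sum_card_indepPairs [Fintype V] {k : ℕ}
    {D : Finset (Submodule F V)} (hD : IsSubspaceDesign F 2 k 1 (D : Set (Submodule F V)))
    (S T : Submodule F V) :
    ∑ B ∈ D, (indepPairs (B ⊓ S) (B ⊓ T)).card = (indepPairs S T).card := by
  classical
  let r : V × V → Submodule F V → Prop := fun p B => p.1 ∈ B ∧ p.2 ∈ B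
  have hcount := Finset.sum_card_bipartiteAbove_eq_sum_card_bipartiteBelow
    (s := indepPairs S T) (t := D) r
  have habove : ∀ p ∈ indepPairs S T, (D.bipartiteAbove r p).card = 1 := by
    intro p hp
    simp only [indepPairs, Finset.mem_filter, Finset.mem_univ, true_and] at hp
    rw [← hD.2 _ (finrank_span_pair_eq_two hp.2.2.1 hp.2.2.2), ← Set.ncard_coe_finset]
    congr 1
    ext B
    simp [Finset.bipartiteAbove, r, Submodule.span_le, Set.pair_subset_iff]
  rw [Finset.sum_congr rfl habove, Finset.sum_const, smul_eq_mul, mul_one] at hcount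
  rw [hcount]
  refine Finset.sum_congr rfl fun B _ => congrArg Finset.card ?_
  ext p
  simp only [indepPairs, Finset.bipartiteBelow, r, Finset.mem_filter, Finset.mem_univ, true_and,
    Submodule.mem_inf]
  tauto

theorem sum_finrank_inf_eq_sum_interNum {n : ℕ} {D : Finset (Submodule F V)}
    {S : Submodule F V} (hn : ∀ B ∈ D, Module.finrank F ↥(B ⊓ S) < n) (f : ℕ → ℤ) :
    ∑ B ∈ D, f (Module.finrank F ↥(B ⊓ S)) =
      ∑ i ∈ Finset.range n, (interNum (D : Set (Submodule F V)) S i : ℤ) * f i := by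
  classical
  rw [← Finset.sum_fiberwise_of_maps_to (t := Finset.range n)
    (g := fun B => Module.finrank F ↥(B ⊓ S)) (fun B hB => Finset.mem_range.2 (hn B hB))]
  refine Finset.sum_congr rfl fun i _ => ?_
  rw [Finset.sum_congr rfl fun B hB => congrArg f (Finset.mem_filter.1 hB).2, Finset.sum_const,
    nsmul_eq_mul, interNum, ← Set.ncard_coe_finset]
  simp

end

theorem interNum_eq_of_equations {q a b c : ℤ} (hq : 2 ≤ q)
    (h₁ : (a + b + c) * ((q ^ 3 - 1) * (q ^ 3 - q)) = (q ^ 7 - 1) * (q ^ 7 - q))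
    (h₂ : (a * (q - 1) + b * (q ^ 2 - 1) + c * (q ^ 3 - 1)) * (q ^ 3 - q) =
      (q ^ 5 - 1) * (q ^ 7 - q))
    (h₃ : b * ((q ^ 2 - 1) * (q ^ 2 - q)) + c * ((q ^ 3 - 1) * (q ^ 3 - q)) =
      (q ^ 5 - 1) * (q ^ 5 - q)) :
    a = q ^ 8 ∧ b = q ^ 3 * (q + 1) * (q ^ 2 + 1) ∧ c = q ^ 2 + 1 := by
  have hq0 : q ≠ 0 := by lia
  have hq1 : q - 1 ≠ 0 := by lia
  have hq2 : q + 1 ≠ 0 := by lia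
  have hq3 : q ^ 2 + q + 1 ≠ 0 := by positivity
  have e₁ : a + b + c = (q ^ 6 + q ^ 5 + q ^ 4 + q ^ 3 + q ^ 2 + q + 1) * (q ^ 2 - q + 1) := by
    have : q * (q - 1) ^ 2 * (q + 1) * (q ^ 2 + q + 1) ≠ 0 := by positivity
    apply mul_left_cancel₀ this
    linear_combination h₁
  have e₂ : a + b * (q + 1) + c * (q ^ 2 + q + 1) =
      (q ^ 4 + q ^ 3 + q ^ 2 + q + 1) * (q ^ 4 + q ^ 2 + 1) := by
    have : q * (q - 1) ^ 2 * (q + 1) ≠ 0 := by positivity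
    apply mul_left_cancel₀ this
    linear_combination h₂
  have e₃ : b + c * (q ^ 2 + q + 1) = (q ^ 4 + q ^ 3 + q ^ 2 + q + 1) * (q ^ 2 + 1) := by
    have : q * (q - 1) ^ 2 * (q + 1) ≠ 0 := by positivity
    apply mul_left_cancel₀ this
    linear_combination h₃
  have hc : c = q ^ 2 + 1 := by
    apply mul_left_cancel₀ (pow_ne_zero 3 hq0)
    linear_combination q * e₃ - e₂ + e₁
  subst hc
  have hb : b = q ^ 3 * (q + 1) * (q ^ 2 + 1) := by linear_combination e₃
  subst hb
  exact ⟨by linear_combination e₁, rfl, rfl⟩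

/-- In a `2-(7,3,1)_q` subspace design, every `5`-dimensional subspace `S` contains
exactly `q² + 1` blocks; more precisely its intersection vector is
`(0, q⁸, q³(q+1)(q²+1), q²+1)`. -/
theorem fano_interNum_dim5 {q : ℕ} (hq : IsPrimePow q)
    {F : Type*} [Field F] [Fintype F] (hF : Fintype.card F = q)
    {V : Type*} [AddCommGroup V] [Module F V] [FiniteDimensional F V]
    (hV : Module.finrank F V = 7)
    (D : Set (Submodule F V)) (hD : IsSubspaceDesign F 2 3 1 D)
    (S : Submodule F V) (hS : Module.finrank F S = 5) :
    {B ∈ D | B ≤ S}.ncard = q ^ 2 + 1 ∧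
      interNum D S 0 = 0 ∧
      interNum D S 1 = q ^ 8 ∧
      interNum D S 2 = q ^ 3 * (q + 1) * (q ^ 2 + 1) ∧
      interNum D S 3 = q ^ 2 + 1 := by
  classical
  have : Finite V := Module.finite_of_finite F
  have := Fintype.ofFinite V
  obtain ⟨D, rfl⟩ := D.toFinite.exists_finset_coe
  have hdim : ∀ B ∈ D, Module.finrank F B = 3 := hD.1
  have hlt : ∀ B ∈ D, Module.finrank F ↥(B ⊓ S) < 4 := fun B hB => by
    have := Submodule.finrank_mono (inf_le_left : B ⊓ S ≤ B)
    have := hdim B hB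
    lia
  have hzero : interNum (D : Set (Submodule F V)) S 0 = 0 := by
    rw [interNum, Set.ncard_eq_zero, Set.eq_empty_iff_forall_notMem]
    rintro B ⟨hB, hB0⟩
    have := Submodule.finrank_sup_add_finrank_inf_eq B S
    have := Submodule.finrank_le (B ⊔ S)
    have := hdim B hB
    lia
  have hthree : {B ∈ (D : Set (Submodule F V)) | B ≤ S} =
      {B ∈ (D : Set (Submodule F V)) | Module.finrank F ↥(B ⊓ S) = 3} := by
    ext B
    refine and_congr_right fun hB => ⟨fun h => by rw [inf_eq_left.2 h, hdim B hB], fun h => ?_⟩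
    exact inf_eq_left.1 (Submodule.eq_of_le_of_finrank_eq inf_le_left (h.trans (hdim B hB).symm))
  have hsum (T U : Submodule F V) (hTU : T ≤ U) :
      ∑ B ∈ D, ((q : ℤ) ^ Module.finrank F ↥(B ⊓ T) - 1) *
          ((q : ℤ) ^ Module.finrank F ↥(B ⊓ U) - q) =
        ((q : ℤ) ^ Module.finrank F T - 1) * ((q : ℤ) ^ Module.finrank F U - q) := by
    have h := hD.sum_card_indepPairs T U
    rw [← hF, ← card_indepPairs hTU, ← h, Nat.cast_sum]
    exact Finset.sum_congr rfl fun B _ => (card_indepPairs (inf_le_inf_left B hTU)).symm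
  have h₁ := hsum ⊤ ⊤ le_rfl
  have h₂ := hsum S ⊤ le_top
  have h₃ := hsum S S le_rfl
  simp only [finrank_top, hV, hS] at h₁ h₂ h₃
  rw [Finset.sum_congr rfl fun B hB => by rw [inf_top_eq, hdim B hB],
    sum_finrank_inf_eq_sum_interNum hlt fun _ => ((q : ℤ) ^ 3 - 1) * ((q : ℤ) ^ 3 - q)] at h₁
  rw [Finset.sum_congr rfl fun B hB => by rw [inf_top_eq, hdim B hB],
    sum_finrank_inf_eq_sum_interNum hlt fun i => ((q : ℤ) ^ i - 1) * ((q : ℤ) ^ 3 - q)] at h₂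
  rw [sum_finrank_inf_eq_sum_interNum hlt fun i => ((q : ℤ) ^ i - 1) * ((q : ℤ) ^ i - q)] at h₃
  simp only [Finset.sum_range_succ, Finset.sum_range_zero, hzero] at h₁ h₂ h₃
  obtain ⟨ha, hb, hc⟩ := interNum_eq_of_equations (q := q)
    (a := interNum (D : Set (Submodule F V)) S 1) (b := interNum (D : Set (Submodule F V)) S 2)
    (c := interNum (D : Set (Submodule F V)) S 3) (by exact_mod_cast hq.two_le)
    (by linear_combination h₁) (by linear_combination h₂) (by linear_combination h₃)
  have hc' : interNum (D : Set (Submodule F V)) S 3 = q ^ 2 + 1 := by exact_mod_cast hc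
  exact ⟨by rw [hthree]; exact hc', hzero, by exact_mod_cast ha, by exact_mod_cast hb, hc'⟩
end

section
/- Let q be a prime power, V a 7-dimensional vector space over 𝔽_q, and D a 2-(7,3,1)_q subspace design on V. Then every 4-dimensional subspace S of V contains at most one block of D, and its intersection vector is one of exactly two possibilities: if S contains a block then (α_0(S), α_1(S), α_2(S), α_3(S)) = (q⁸ − q⁷, q⁷ + q⁶ + q⁵, q⁴ + q³ + q², 1), and if S contains no block then (α_0(S), α_1(S), α_2(S), α_3(S)) = (q⁸ − q⁷ + q³, q⁷ + q⁶ + q⁵ − q³ − q² − q, q⁴ + q³ + 2q² + q + 1, 0). -/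
open Module in
theorem card_filter_mem_notMem {F V : Type*} [Field F] [Fintype F] [AddCommGroup V] [Module F V]
    [Fintype V] {W U : Submodule F V} (hUW : U ≤ W) [DecidablePred (· ∈ W)]
    [DecidablePred (· ∈ U)] :
    ((Finset.univ.filter fun x : V => x ∈ W ∧ x ∉ U).card : ℤ) =
      (Fintype.card F : ℤ) ^ finrank F W - (Fintype.card F : ℤ) ^ finrank F U := by
  classical
  have key (X : Submodule F V) [DecidablePred (· ∈ X)] :
      (Finset.univ.filter fun x : V => x ∈ X).card = Fintype.card F ^ finrank F X := by
    rw [← Fintype.card_subtype, ← Module.card_eq_pow_finrank (K := F) (V := X)]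
  have h : (Finset.univ.filter fun x : V => x ∈ W ∧ x ∉ U) =
      (Finset.univ.filter fun x : V => x ∈ W) \ (Finset.univ.filter fun x : V => x ∈ U) := by
    ext x
    simp
  have hsub : (Finset.univ.filter fun x : V => x ∈ U) ⊆
      (Finset.univ.filter fun x : V => x ∈ W) := by
    intro x
    simpa using fun hx => hUW hx
  rw [h, Finset.cast_card_sdiff hsub, key, key]
  push_cast
  rfl

open Module in
open scoped Classical in
/-- Weighted double counting of the pairs `(x, B)` with `B ∈ D` and `x ∈ B ⊓ W`, `x ∉ U`. -/
theorem sum_mul_pow_finrank_sub {F V : Type*} [Field F] [Fintype F] [AddCommGroup V]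
    [Module F V] [Fintype V] (D : Finset (Submodule F V)) {W U : Submodule F V} (hUW : U ≤ W)
    (hD : ∀ B ∈ D, U ≤ B) (f : Submodule F V → ℤ) :
    ∑ B ∈ D, f B * ((Fintype.card F : ℤ) ^ finrank F ↥(B ⊓ W) - Fintype.card F ^ finrank F U) =
      ∑ x : V with x ∈ W ∧ x ∉ U, ∑ B ∈ D with x ∈ B, f B := by
  have h : ∀ B ∈ D, f B *
      ((Fintype.card F : ℤ) ^ finrank F ↥(B ⊓ W) - Fintype.card F ^ finrank F U) =
      ∑ x : V with x ∈ B ⊓ W ∧ x ∉ U, f B := by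
    intro B hB
    rw [← card_filter_mem_notMem (le_inf (hD B hB) hUW), Finset.sum_const, nsmul_eq_mul, mul_comm]
  rw [Finset.sum_congr rfl h]
  refine Finset.sum_comm' fun B x => ?_
  simp only [Finset.mem_filter, Finset.mem_univ, true_and, Submodule.mem_inf]
  tauto

open Module in
open scoped Classical in
theorem IsSubspaceDesign.card_filter_mem_mem {F V : Type*} [Field F] [AddCommGroup V]
    [Module F V] [Finite V] {k : ℕ} {D : Set (Submodule F V)} (hD : IsSubspaceDesign F 2 k 1 D)
    {x y : V} (hx : x ≠ 0) (hy : y ∉ Submodule.span F {x}) :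
    (((Set.toFinite D).toFinset.filter (x ∈ ·)).filter (y ∈ ·)).card = 1 := by
  have hli : LinearIndependent F ![x, y] := by
    rw [LinearIndependent.pair_iff' hx]
    exact fun a ha => hy (Submodule.mem_span_singleton.2 ⟨a, ha⟩)
  have h2 : finrank F (Submodule.span F (Set.range ![x, y])) = 2 := by
    simpa using finrank_span_eq_card hli
  rw [← hD.2 _ h2, ← Set.ncard_coe_finset]
  congr 1
  ext B
  simp [Submodule.span_le, Set.insert_subset_iff]
  tauto

open Module in
open scoped Classical in
theorem IsSubspaceDesign.sum_pow_finrank_sub_card {F V : Type*} [Field F] [Fintype F]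
    [AddCommGroup V] [Module F V] [Fintype V] {k : ℕ} {D : Set (Submodule F V)}
    (hD : IsSubspaceDesign F 2 k 1 D) {x : V} (hx : x ≠ 0) {W : Submodule F V} (hxW : x ∈ W) :
    ∑ B ∈ (Set.toFinite D).toFinset with x ∈ B,
      ((Fintype.card F : ℤ) ^ finrank F ↥(B ⊓ W) - Fintype.card F) =
      (Fintype.card F : ℤ) ^ finrank F W - Fintype.card F := by
  have hUW : Submodule.span F {x} ≤ W := by simpa using hxW
  have h := sum_mul_pow_finrank_sub ((Set.toFinite D).toFinset.filter (x ∈ ·)) hUW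
    (by simp) (fun _ => 1)
  have hs : ∀ y ∈ Finset.univ.filter (fun y : V => y ∈ W ∧ y ∉ Submodule.span F {x}),
      (∑ B ∈ (Set.toFinite D).toFinset.filter (x ∈ ·) with y ∈ B, (1 : ℤ)) = 1 := by
    intro y hy
    rw [Finset.sum_const, hD.card_filter_mem_mem hx (Finset.mem_filter.1 hy).2.2, one_smul]
  rw [Finset.sum_congr rfl hs, Finset.sum_const, nsmul_eq_mul, mul_one,
    card_filter_mem_notMem hUW, finrank_span_singleton hx] at h
  simpa using h

open Module in
open scoped Classical in
/-- Double counting of the ordered pairs of independent vectors of `W` lying in a common block. -/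
theorem IsSubspaceDesign.sum_pow_finrank_pairs {F V : Type*} [Field F] [Fintype F]
    [AddCommGroup V] [Module F V] [Fintype V] {k : ℕ} {D : Set (Submodule F V)}
    (hD : IsSubspaceDesign F 2 k 1 D) (W : Submodule F V) :
    ∑ B ∈ (Set.toFinite D).toFinset, ((Fintype.card F : ℤ) ^ finrank F ↥(B ⊓ W) - Fintype.card F) *
        ((Fintype.card F : ℤ) ^ finrank F ↥(B ⊓ W) - 1) =
      ((Fintype.card F : ℤ) ^ finrank F W - 1) *
        ((Fintype.card F : ℤ) ^ finrank F W - Fintype.card F) := by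
  have h := sum_mul_pow_finrank_sub (Set.toFinite D).toFinset (bot_le : ⊥ ≤ W) (by simp)
    (fun B => (Fintype.card F : ℤ) ^ finrank F ↥(B ⊓ W) - Fintype.card F)
  have hs : ∀ x ∈ Finset.univ.filter (fun x : V => x ∈ W ∧ x ∉ (⊥ : Submodule F V)),
      ∑ B ∈ (Set.toFinite D).toFinset with x ∈ B,
        ((Fintype.card F : ℤ) ^ finrank F ↥(B ⊓ W) - Fintype.card F) =
        (Fintype.card F : ℤ) ^ finrank F W - Fintype.card F := by
    intro x hx
    rw [Finset.mem_filter, Submodule.mem_bot] at hx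
    exact hD.sum_pow_finrank_sub_card hx.2.2 hx.2.1
  rw [Finset.sum_congr rfl hs, Finset.sum_const, nsmul_eq_mul, card_filter_mem_notMem bot_le] at h
  simpa using h

open Module in
open scoped Classical in
theorem IsSubspaceDesign.card_filter_mem_mul {F V : Type*} [Field F] [Fintype F]
    [AddCommGroup V] [Module F V] [Fintype V] {k : ℕ} {D : Set (Submodule F V)}
    (hD : IsSubspaceDesign F 2 k 1 D) {x : V} (hx : x ≠ 0) :
    (((Set.toFinite D).toFinset.filter (x ∈ ·)).card : ℤ) *
      ((Fintype.card F : ℤ) ^ k - Fintype.card F) =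
      (Fintype.card F : ℤ) ^ finrank F V - Fintype.card F := by
  have h := hD.sum_pow_finrank_sub_card hx (Submodule.mem_top (x := x))
  rw [finrank_top] at h
  rw [← h, ← nsmul_eq_mul, ← Finset.sum_const]
  refine Finset.sum_congr rfl fun B hB => ?_
  rw [inf_top_eq, hD.1 B (by simpa using (Finset.mem_filter.1 hB).1)]

open Module in
theorem IsSubspaceDesign.sum_pow_finrank_sub_one {F V : Type*} [Field F] [Fintype F]
    [AddCommGroup V] [Module F V] [Fintype V] {k : ℕ} {D : Set (Submodule F V)}
    (hD : IsSubspaceDesign F 2 k 1 D) {r : ℤ}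
    (hr : ((Fintype.card F : ℤ) ^ finrank F V - Fintype.card F) =
      r * ((Fintype.card F : ℤ) ^ k - Fintype.card F))
    (hk : (Fintype.card F : ℤ) ^ k - Fintype.card F ≠ 0) (W : Submodule F V) :
    ∑ B ∈ (Set.toFinite D).toFinset, ((Fintype.card F : ℤ) ^ finrank F ↥(B ⊓ W) - 1) =
      ((Fintype.card F : ℤ) ^ finrank F W - 1) * r := by
  classical
  have h := sum_mul_pow_finrank_sub (Set.toFinite D).toFinset (bot_le : ⊥ ≤ W) (by simp)
    (fun _ => 1)
  have hs : ∀ x ∈ Finset.univ.filter (fun x : V => x ∈ W ∧ x ∉ (⊥ : Submodule F V)),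
      ∑ B ∈ (Set.toFinite D).toFinset with x ∈ B, (1 : ℤ) = r := by
    intro x hx
    rw [Finset.mem_filter, Submodule.mem_bot] at hx
    rw [Finset.sum_const, nsmul_eq_mul, mul_one]
    exact mul_right_cancel₀ hk ((hD.card_filter_mem_mul hx.2.2).trans hr)
  rw [Finset.sum_congr rfl hs, Finset.sum_const, nsmul_eq_mul, card_filter_mem_notMem bot_le] at h
  simpa using h

open Module in
theorem sum_finrank_inf_eq_sum_interNum_s15 {F V : Type*} [Field F] [AddCommGroup V] [Module F V]
    [Finite V] {k : ℕ} {D : Set (Submodule F V)} (hk : ∀ B ∈ D, finrank F B = k)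
    (S : Submodule F V) (g : ℕ → ℤ) :
    ∑ B ∈ (Set.toFinite D).toFinset, g (finrank F ↥(B ⊓ S)) =
      ∑ i ∈ Finset.range (k + 1), (interNum D S i : ℤ) * g i := by
  classical
  have : Module.Finite F V := Module.Finite.of_finite
  have hmaps : ∀ B ∈ (Set.toFinite D).toFinset, finrank F ↥(B ⊓ S) ∈ Finset.range (k + 1) := by
    intro B hB
    rw [Finset.mem_range, Nat.lt_succ_iff, ← hk B (by simpa using hB)]
    exact Submodule.finrank_mono inf_le_left
  rw [← Finset.sum_fiberwise_of_maps_to' hmaps]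
  refine Finset.sum_congr rfl fun i _ => ?_
  rw [Finset.sum_const, nsmul_eq_mul, interNum, ← Set.ncard_coe_finset]
  congr 3
  ext B
  simp

open Module in
theorem IsSubspaceDesign.subsingleton_blocks_le {F V : Type*} [Field F] [AddCommGroup V]
    [Module F V] [Finite V] {k : ℕ} {D : Set (Submodule F V)} (hD : IsSubspaceDesign F 2 k 1 D)
    {S : Submodule F V} (hS : finrank F S + 2 ≤ 2 * k) : {B ∈ D | B ≤ S}.Subsingleton := by
  have : Module.Finite F V := Module.Finite.of_finite
  rintro A ⟨hA, hAS⟩ B ⟨hB, hBS⟩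
  have hsup := Submodule.finrank_mono (sup_le hAS hBS)
  have hadd := Submodule.finrank_sup_add_finrank_inf_eq A B
  rw [hD.1 A hA, hD.1 B hB] at hadd
  obtain ⟨f, hf⟩ := exists_linearIndependent_of_le_finrank
    (show 2 ≤ finrank F ↥(A ⊓ B) by omega)
  have hf' : LinearIndependent F ((A ⊓ B).subtype ∘ f) := hf.map' _ (Submodule.ker_subtype _)
  have hT : finrank F (Submodule.span F (Set.range ((A ⊓ B).subtype ∘ f))) = 2 := by
    simpa using finrank_span_eq_card hf'
  have hle : Submodule.span F (Set.range ((A ⊓ B).subtype ∘ f)) ≤ A ⊓ B := by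
    rw [Submodule.span_le]
    rintro _ ⟨i, rfl⟩
    exact (f i).2
  exact (Set.ncard_le_one (Set.toFinite _)).1 (hD.2 _ hT).le A ⟨hA, hle.trans inf_le_left⟩
    B ⟨hB, hle.trans inf_le_right⟩

/-- In a `2-(7,3,1)_q` subspace design, every `4`-dimensional subspace `S` contains
at most one block, and its intersection vector is one of exactly two possibilities:
`(q⁸ − q⁷, q⁷ + q⁶ + q⁵, q⁴ + q³ + q², 1)` if `S` contains a block, and
`(q⁸ − q⁷ + q³, q⁷ + q⁶ + q⁵ − q³ − q² − q, q⁴ + q³ + 2q² + q + 1, 0)` otherwise. -/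
theorem fano_interNum_dim4 {q : ℕ} (hq : IsPrimePow q)
    {F : Type*} [Field F] [Fintype F] (hF : Fintype.card F = q)
    {V : Type*} [AddCommGroup V] [Module F V] [FiniteDimensional F V]
    (hV : Module.finrank F V = 7)
    (D : Set (Submodule F V)) (hD : IsSubspaceDesign F 2 3 1 D)
    (S : Submodule F V) (hS : Module.finrank F S = 4) :
    {B ∈ D | B ≤ S}.ncard ≤ 1 ∧
      ((∃ B ∈ D, B ≤ S) →
        interNum D S 0 = q ^ 8 - q ^ 7 ∧
        interNum D S 1 = q ^ 7 + q ^ 6 + q ^ 5 ∧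
        interNum D S 2 = q ^ 4 + q ^ 3 + q ^ 2 ∧
        interNum D S 3 = 1) ∧
      (¬ (∃ B ∈ D, B ≤ S) →
        interNum D S 0 = q ^ 8 - q ^ 7 + q ^ 3 ∧
        interNum D S 1 = q ^ 7 + q ^ 6 + q ^ 5 - q ^ 3 - q ^ 2 - q ∧
        interNum D S 2 = q ^ 4 + q ^ 3 + 2 * q ^ 2 + q + 1 ∧
        interNum D S 3 = 0) := by
  have : Finite V := Module.finite_of_finite F
  have := Fintype.ofFinite V
  have hss := hD.subsingleton_blocks_le (S := S) (by omega)
  have hle : {B ∈ D | B ≤ S}.ncard ≤ 1 :=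
    (Set.ncard_le_one (Set.toFinite _)).2 fun A hA B hB => hss hA hB
  have h3 : interNum D S 3 = {B ∈ D | B ≤ S}.ncard := by
    unfold interNum
    congr 1
    ext B
    refine and_congr_right fun hB => ⟨fun h => ?_, fun h => ?_⟩
    · exact inf_eq_left.1 (Submodule.eq_of_le_of_finrank_eq inf_le_left (h.trans (hD.1 B hB).symm))
    · rw [inf_eq_left.2 h, hD.1 B hB]
  have hq2 : (2 : ℤ) ≤ q := by exact_mod_cast hq.two_le
  have hr : ((q : ℤ) ^ 7 - q) = (q ^ 4 + q ^ 2 + 1) * (q ^ 3 - q) := by ring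
  have hq1 : (q : ℤ) - 1 ≠ 0 := by linarith
  have hqq : (q : ℤ) ^ 2 - q ≠ 0 := by nlinarith
  have hqs : (q : ℤ) ^ 2 - 1 ≠ 0 := by nlinarith
  have hk : (q : ℤ) ^ 3 - q ≠ 0 := by nlinarith
  have hk1 : (q : ℤ) ^ 3 - 1 ≠ 0 := by nlinarith
  have hD1 : ∀ W : Submodule F V, _ := hD.sum_pow_finrank_sub_one (r := (q ^ 4 + q ^ 2 + 1 : ℤ))
    (by rw [hF, hV]; exact hr) (by rwa [hF])
  have e0 := sum_finrank_inf_eq_sum_interNum_s15 hD.1 S fun _ => ((q : ℤ) ^ 3 - 1)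
  have e1 := sum_finrank_inf_eq_sum_interNum_s15 hD.1 S fun i => ((q : ℤ) ^ i - 1)
  have e2 := sum_finrank_inf_eq_sum_interNum_s15 hD.1 S fun i => ((q : ℤ) ^ i - q) * ((q : ℤ) ^ i - 1)
  have hS2 := hD.sum_pow_finrank_pairs S
  have hS1 := hD1 S
  have hT1 := hD1 ⊤
  have hb : ∑ B ∈ (Set.toFinite D).toFinset,
      ((q : ℤ) ^ Module.finrank F ↥(B ⊓ ⊤) - 1) =
      ∑ B ∈ (Set.toFinite D).toFinset, ((q : ℤ) ^ 3 - 1) :=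
    Finset.sum_congr rfl fun B hB => by rw [inf_top_eq, hD.1 B (by simpa using hB)]
  rw [hF] at hS1 hS2 hT1
  rw [finrank_top, hV, hb, e0] at hT1
  rw [e1, hS] at hS1
  rw [e2, hS] at hS2
  simp only [Finset.sum_range_succ, Finset.sum_range_zero] at hS1 hS2 hT1
  have hpow : q ^ 7 ≤ q ^ 8 := Nat.pow_le_pow_right (by have := hq.two_le; omega) (by norm_num)
  refine ⟨hle, fun hex => ?_, fun hex => ?_⟩
  · have a3 : interNum D S 3 = 1 := by
      obtain ⟨B, hB⟩ := hex
      exact h3.trans (le_antisymm hle ((Set.ncard_pos (Set.toFinite _)).2 ⟨B, hB⟩))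
    rw [a3] at hS1 hS2 hT1
    have a2 : (interNum D S 2 : ℤ) = q ^ 4 + q ^ 3 + q ^ 2 :=
      mul_right_cancel₀ (mul_ne_zero hqq hqs) (by linear_combination hS2)
    have a1 : (interNum D S 1 : ℤ) = q ^ 7 + q ^ 6 + q ^ 5 :=
      mul_right_cancel₀ hq1 (by rw [a2] at hS1; linear_combination hS1)
    have a0 : (interNum D S 0 : ℤ) = q ^ 8 - q ^ 7 :=
      mul_right_cancel₀ hk1 (by rw [a2, a1] at hT1; linear_combination hT1)
    refine ⟨?_, by exact_mod_cast a1, by exact_mod_cast a2, a3⟩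
    zify [hpow]
    exact a0
  · have a3 : interNum D S 3 = 0 := by
      rw [h3, Set.ncard_eq_zero (Set.toFinite _)]
      exact Set.eq_empty_of_forall_notMem fun B hB => hex ⟨B, hB⟩
    rw [a3] at hS1 hS2 hT1
    have a2 : (interNum D S 2 : ℤ) = q ^ 4 + q ^ 3 + 2 * q ^ 2 + q + 1 :=
      mul_right_cancel₀ (mul_ne_zero hqq hqs) (by linear_combination hS2)
    have a1 : (interNum D S 1 : ℤ) = q ^ 7 + q ^ 6 + q ^ 5 - q ^ 3 - q ^ 2 - q :=
      mul_right_cancel₀ hq1 (by rw [a2] at hS1; linear_combination hS1)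
    have a0 : (interNum D S 0 : ℤ) = q ^ 8 - q ^ 7 + q ^ 3 :=
      mul_right_cancel₀ hk1 (by rw [a2, a1] at hT1; linear_combination hT1)
    refine ⟨?_, ?_, by exact_mod_cast a2, a3⟩
    · zify [hpow]
      exact a0
    · have a1' : interNum D S 1 + q ^ 3 + q ^ 2 + q = q ^ 7 + q ^ 6 + q ^ 5 := by
        zify
        linear_combination a1
      omega
end

section
/- Let q be a prime power, V a 7-dimensional vector space over 𝔽_q, and D a 2-(7,3,1)_q subspace design on V. Then the number of 4-dimensional subspaces of V containing a block of D equals (q³ + q² + q + 1)(q⁸ + q⁶ + q⁵ + q⁴ + q³ + q² + 1), and the number of 4-dimensional subspaces of V containing no block of D equals q⁴(q⁸ + q⁶ + q⁵ + q⁴ + q³ + q² + 1). -/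
theorem ncard_mul_eq_ncard_mul_of_rel {α β : Type*} [Finite α] [Finite β] (A : Set α) (B : Set β)
    (r : α → β → Prop) (m n : ℕ) (hA : ∀ a ∈ A, {b ∈ B | r a b}.ncard = m)
    (hB : ∀ b ∈ B, {a ∈ A | r a b}.ncard = n) : A.ncard * m = B.ncard * n := by
  classical
  have := Fintype.ofFinite α
  have := Fintype.ofFinite β
  rw [Set.ncard_eq_toFinset_card' A, Set.ncard_eq_toFinset_card' B]
  refine Finset.card_mul_eq_card_mul r (fun a ha => ?_) fun b hb => ?_
  · rw [← hA a (by simpa using ha), Set.ncard_eq_toFinset_card']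
    congr 1
    ext
    simp [Finset.bipartiteAbove]
  · rw [← hB b (by simpa using hb), Set.ncard_eq_toFinset_card']
    congr 1
    ext
    simp [Finset.bipartiteBelow]

theorem isSubspaceDesign_finrank_eq {F V : Type*} [Field F] [AddCommGroup V] [Module F V]
    [FiniteDimensional F V] (k : ℕ) :
    IsSubspaceDesign F k k 1 {S : Submodule F V | Module.finrank F S = k} := by
  refine ⟨fun _ h => h, fun T hT => Set.ncard_eq_one.2 ⟨T, ?_⟩⟩
  ext S
  constructor
  · rintro ⟨hS, hTS⟩
    exact (Submodule.eq_of_le_of_finrank_eq hTS (hT.trans hS.symm)).symm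
  · rintro rfl
    exact ⟨hT, le_rfl⟩

theorem eq_of_le_of_design {F V : Type*} [Field F] [AddCommGroup V] [Module F V]
    [FiniteDimensional F V] {t : ℕ} {D : Set (Submodule F V)}
    (hD : IsSubspaceDesign F t (t + 1) 1 D) {B B' S : Submodule F V} (hB : B ∈ D) (hB' : B' ∈ D)
    (hS : Module.finrank F S = t + 2) (hBS : B ≤ S) (hB'S : B' ≤ S) : B = B' := by
  have hsup := Submodule.finrank_sup_add_finrank_inf_eq B B'
  have hle := Submodule.finrank_mono (sup_le hBS hB'S)
  rw [hD.1 B hB, hD.1 B' hB'] at hsup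
  obtain ⟨f, hf⟩ := exists_linearIndependent_of_le_finrank (R := F) (M := ↥(B ⊓ B')) (n := t)
    (by omega)
  have hTt : Module.finrank F (Submodule.span F (Set.range ((B ⊓ B').subtype ∘ f))) = t := by
    simpa using finrank_span_eq_card (hf.map' (B ⊓ B').subtype (B ⊓ B').ker_subtype)
  set T := Submodule.span F (Set.range ((B ⊓ B').subtype ∘ f))
  have hT : T ≤ B ⊓ B' := by
    rw [Submodule.span_le]
    rintro _ ⟨i, rfl⟩
    exact (f i).2
  obtain ⟨C, hC⟩ := Set.ncard_eq_one.1 (hD.2 T hTt)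
  have hBC : B ∈ {B ∈ D | T ≤ B} := ⟨hB, hT.trans inf_le_left⟩
  have hBC' : B' ∈ {B ∈ D | T ≤ B} := ⟨hB', hT.trans inf_le_right⟩
  rw [hC] at hBC hBC'
  exact hBC.trans hBC'.symm

section Counting

variable {F V : Type*} [Field F] [Fintype F] [AddCommGroup V] [Module F V] [FiniteDimensional F V]

theorem ncard_linearIndependent {m : ℕ} (hm : m ≤ Module.finrank F V) :
    {s : Fin m → V | LinearIndependent F s}.ncard =
      ∏ i : Fin m, (Fintype.card F ^ Module.finrank F V - Fintype.card F ^ (i : ℕ)) := by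
  have : Finite V := Module.finite_of_finite F
  have := Fintype.ofFinite V
  exact card_linearIndependent hm

theorem ncard_linearIndependent_range_subset (X : Submodule F V) {m : ℕ}
    (hm : m ≤ Module.finrank F X) :
    {s ∈ {s : Fin m → V | LinearIndependent F s} | Set.range s ⊆ X}.ncard =
      ∏ i : Fin m, (Fintype.card F ^ Module.finrank F X - Fintype.card F ^ (i : ℕ)) := by
  rw [← ncard_linearIndependent hm,
    ← Set.ncard_image_of_injective _ (X.injective_subtype.comp_left (α := Fin m))]
  congr 1
  ext s
  constructor
  · rintro ⟨hs, hsX⟩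
    refine ⟨fun i => ⟨s i, hsX ⟨i, rfl⟩⟩, ?_, rfl⟩
    exact LinearIndependent.of_comp X.subtype hs
  · rintro ⟨t, ht, rfl⟩
    refine ⟨ht.map' X.subtype X.ker_subtype, ?_⟩
    rintro _ ⟨i, rfl⟩
    exact (t i).2

theorem ncard_mul_prod_eq_of_design {m d : ℕ} (hmd : m ≤ d) (hmV : m ≤ Module.finrank F V)
    {D : Set (Submodule F V)} (hD : IsSubspaceDesign F m d 1 D) :
    D.ncard * ∏ i : Fin m, (Fintype.card F ^ d - Fintype.card F ^ (i : ℕ)) =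
      ∏ i : Fin m, (Fintype.card F ^ Module.finrank F V - Fintype.card F ^ (i : ℕ)) := by
  have : Finite V := Module.finite_of_finite F
  rw [← ncard_linearIndependent hmV]
  refine (ncard_mul_eq_ncard_mul_of_rel D {s : Fin m → V | LinearIndependent F s}
    (fun X s => Set.range s ⊆ X) _ 1 (fun X hX => ?_) fun s hs => ?_).trans (mul_one _)
  · have hXd := hD.1 X hX
    rw [← hXd]
    exact ncard_linearIndependent_range_subset X (hXd ▸ hmd)
  · simp only [← Submodule.span_le]
    exact hD.2 _ (by simpa using finrank_span_eq_card hs)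

theorem ncard_sdiff_of_le {B S : Submodule F V} (h : B ≤ S) :
    ((S : Set V) \ B).ncard =
      Fintype.card F ^ Module.finrank F S - Fintype.card F ^ Module.finrank F B := by
  have : Finite V := Module.finite_of_finite F
  have hcard (X : Submodule F V) :
      (X : Set V).ncard = Fintype.card F ^ Module.finrank F X := by
    rw [← Nat.card_eq_fintype_card, ← Module.natCard_eq_pow_finrank (K := F)]
    rfl
  rw [Set.ncard_sdiff (by exact h), hcard, hcard]

theorem ncard_superspaces_mul_eq (B : Submodule F V) :
    {S : Submodule F V | Module.finrank F S = Module.finrank F B + 1 ∧ B ≤ S}.ncard *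
        (Fintype.card F ^ (Module.finrank F B + 1) - Fintype.card F ^ Module.finrank F B) =
      Fintype.card F ^ Module.finrank F V - Fintype.card F ^ Module.finrank F B := by
  have : Finite V := Module.finite_of_finite F
  rw [← finrank_top F V, ← ncard_sdiff_of_le (le_top : B ≤ ⊤)]
  refine (ncard_mul_eq_ncard_mul_of_rel _ _ (fun S v => v ∈ S) _ 1 ?_ ?_).trans (mul_one _)
  · rintro S ⟨hS, hBS⟩
    rw [← hS, ← ncard_sdiff_of_le hBS]
    congr 1
    ext v
    simp [and_comm]
  · rintro v ⟨-, hv⟩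
    have hfin := Submodule.finrank_sup_span_singleton hv
    refine Set.ncard_eq_one.2 ⟨B ⊔ F ∙ v, ?_⟩
    ext S
    constructor
    · rintro ⟨⟨hS, hBS⟩, hvS⟩
      refine (Submodule.eq_of_le_of_finrank_eq (sup_le hBS ?_) (hfin.trans hS.symm)).symm
      exact (Submodule.span_singleton_le_iff_mem _ _).2 hvS
    · rintro rfl
      exact ⟨⟨hfin, le_sup_left⟩,
        (le_sup_right : F ∙ v ≤ _) (Submodule.mem_span_singleton_self v)⟩

end Counting

/-- In a `2-(7,3,1)_q` subspace design on `V`, the number of `4`-dimensional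
subspaces of `V` containing a block is
`(q³+q²+q+1)(q⁸+q⁶+q⁵+q⁴+q³+q²+1)`, and the number of `4`-dimensional subspaces
containing no block is `q⁴(q⁸+q⁶+q⁵+q⁴+q³+q²+1)`. -/
theorem fano_dim4_type_counts {q : ℕ} (hq : IsPrimePow q)
    {F : Type*} [Field F] [Fintype F] (hF : Fintype.card F = q)
    {V : Type*} [AddCommGroup V] [Module F V] [FiniteDimensional F V]
    (hV : Module.finrank F V = 7)
    (D : Set (Submodule F V)) (hD : IsSubspaceDesign F 2 3 1 D) :
    {S : Submodule F V | Module.finrank F S = 4 ∧ ∃ B ∈ D, B ≤ S}.ncard =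
        (q ^ 3 + q ^ 2 + q + 1) *
          (q ^ 8 + q ^ 6 + q ^ 5 + q ^ 4 + q ^ 3 + q ^ 2 + 1) ∧
      {S : Submodule F V | Module.finrank F S = 4 ∧ ¬ ∃ B ∈ D, B ≤ S}.ncard =
        q ^ 4 * (q ^ 8 + q ^ 6 + q ^ 5 + q ^ 4 + q ^ 3 + q ^ 2 + 1) := by
  have : Finite V := Module.finite_of_finite F
  have hq1 : 1 < q := hF ▸ Fintype.one_lt_card
  have hqz : (1 : ℤ) < q := by exact_mod_cast hq1
  have hle (a b : ℕ) (h : a ≤ b) : q ^ a ≤ q ^ b := Nat.pow_le_pow_right hq1.le h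
  have hone (a : ℕ) : 1 ≤ q ^ a := Nat.one_le_pow _ _ (by omega)
  have hblocks := ncard_mul_prod_eq_of_design (by norm_num) (by omega) hD
  have hall := ncard_mul_prod_eq_of_design (by norm_num) (by omega)
    (isSubspaceDesign_finrank_eq (F := F) (V := V) 4)
  have hcont : D.ncard * (q ^ 3 + q ^ 2 + q + 1) =
      {S : Submodule F V | Module.finrank F S = 4 ∧ ∃ B ∈ D, B ≤ S}.ncard := by
    refine (ncard_mul_eq_ncard_mul_of_rel _ _ (fun B S => B ≤ S) _ 1 ?_ ?_).trans (mul_one _)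
    · intro B hB
      have hsup := ncard_superspaces_mul_eq B
      rw [hD.1 B hB, hF, hV] at hsup
      have hset : {S ∈ {S : Submodule F V | Module.finrank F S = 4 ∧ ∃ B ∈ D, B ≤ S} | B ≤ S} =
          {S : Submodule F V | Module.finrank F S = 3 + 1 ∧ B ≤ S} := by
        ext S
        exact ⟨fun h => ⟨h.1.1, h.2⟩, fun h => ⟨⟨h.1, B, hB, h.2⟩, h.2⟩⟩
      rw [hset]
      zify [hle 3 (3 + 1) (by norm_num), hle 3 7 (by norm_num)] at hsup ⊢
      refine mul_right_cancel₀ (b := (q : ℤ) ^ 3 * (q - 1)) ?_ ?_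
      · have : (0 : ℤ) < q - 1 := by linarith
        positivity
      · linear_combination hsup
    · rintro S ⟨hS, B, hB, hBS⟩
      refine Set.ncard_eq_one.2 ⟨B, ?_⟩
      ext B'
      constructor
      · rintro ⟨hB', hB'S⟩
        exact eq_of_le_of_design hD hB' hB hS hB'S hBS
      · rintro rfl
        exact ⟨hB, hBS⟩
  have hsplit : {S : Submodule F V | Module.finrank F S = 4 ∧ ∃ B ∈ D, B ≤ S}.ncard +
      {S : Submodule F V | Module.finrank F S = 4 ∧ ¬ ∃ B ∈ D, B ≤ S}.ncard =
      {S : Submodule F V | Module.finrank F S = 4}.ncard :=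
    Set.ncard_inter_add_ncard_sdiff_eq_ncard {S : Submodule F V | Module.finrank F S = 4}
      {S | ∃ B ∈ D, B ≤ S}
  rw [hF, hV] at hblocks hall
  simp only [Fin.prod_univ_succ, Fin.prod_univ_zero, Fin.val_zero, Fin.val_succ, pow_zero,
    zero_add, mul_one, pow_one, Nat.reduceAdd] at hblocks hall
  have hle1 (b : ℕ) (h : b ≠ 0) : q ≤ q ^ b := Nat.le_self_pow h q
  have hD_card : D.ncard = q ^ 8 + q ^ 6 + q ^ 5 + q ^ 4 + q ^ 3 + q ^ 2 + 1 := by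
    zify [hone, hle1 3 (by norm_num), hle1 7 (by norm_num)] at hblocks ⊢
    have h3 : (0 : ℤ) < (q : ℤ) ^ 3 - 1 := by
      linarith [one_lt_pow₀ hqz (show 3 ≠ 0 by norm_num)]
    have h2 : (0 : ℤ) < (q : ℤ) ^ 3 - q := by nlinarith
    refine mul_right_cancel₀ (mul_pos h3 h2).ne' ?_
    linear_combination hblocks
  have hall_card : {S : Submodule F V | Module.finrank F S = 4}.ncard =
      (q ^ 4 + q ^ 3 + q ^ 2 + q + 1) *
        (q ^ 8 + q ^ 6 + q ^ 5 + q ^ 4 + q ^ 3 + q ^ 2 + 1) := by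
    zify [hone, hle1 4 (by norm_num), hle1 7 (by norm_num), hle 2 4 (by norm_num),
      hle 3 4 (by norm_num), hle 2 7 (by norm_num), hle 3 7 (by norm_num)] at hall ⊢
    have hlt (a : ℕ) (h : a < 4) : (0 : ℤ) < (q : ℤ) ^ 4 - q ^ a :=
      sub_pos.2 (pow_lt_pow_right₀ hqz h)
    have hpos := mul_pos (hlt 0 (by norm_num)) (mul_pos (hlt 1 (by norm_num))
      (mul_pos (hlt 2 (by norm_num)) (hlt 3 (by norm_num))))
    refine mul_right_cancel₀ hpos.ne' ?_
    linear_combination hall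
  rw [hall_card, ← hcont, hD_card] at hsplit
  rw [← hcont, hD_card]
  constructor
  · ring
  · linarith
end

section
/- Let q be a prime power, V a 7-dimensional vector space over 𝔽_q, and D a 2-(7,3,1)_q subspace design on V. Then for every 5-dimensional subspace S of V, the number of 4-dimensional subspaces of S containing a block of D equals q³ + q² + q + 1, and the number of 4-dimensional subspaces of S containing no block of D equals q⁴. -/
open Module

section SubspaceCounting

variable {F V : Type*} [Field F] [AddCommGroup V] [Module F V]

/-- The number of one-dimensional subspaces of a finite-dimensional subspace. -/
theorem ncard_finrank_eq_one_le [Finite F] (X : Submodule F V) :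
    {L : Submodule F V | L ≤ X ∧ finrank F L = 1}.ncard =
      ∑ i ∈ Finset.range (finrank F X), Nat.card F ^ i := by
  rw [← Projectivization.card_of_finrank F X rfl,
    Nat.card_congr (Projectivization.equivSubmodule F X)]
  have h : {L : Submodule F V | L ≤ X ∧ finrank F L = 1} =
      Submodule.map X.subtype '' {L : Submodule F X | finrank F L = 1} := by
    ext L
    constructor
    · rintro ⟨hL, h1⟩
      refine ⟨L.comap X.subtype, ?_, ?_⟩
      · rw [Set.mem_ofPred_eq, ← Submodule.finrank_map_subtype_eq,
          Submodule.map_comap_subtype, inf_eq_right.2 hL, h1]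
      · rw [Submodule.map_comap_subtype, inf_eq_right.2 hL]
    · rintro ⟨M, hM, rfl⟩
      exact ⟨Submodule.map_subtype_le _ _, by rw [Submodule.finrank_map_subtype_eq]; exact hM⟩
  rw [h, Set.ncard_image_of_injective _ (Submodule.map_injective_of_injective X.subtype_injective)]
  rfl

/-- The number of hyperplanes containing a given subspace. -/
theorem ncard_hyperplanes_ge [Finite F] [FiniteDimensional F V] (A : Submodule F V) :
    {W : Submodule F V | A ≤ W ∧ finrank F W + 1 = finrank F V}.ncard =
      ∑ i ∈ Finset.range (finrank F V - finrank F A), Nat.card F ^ i := by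
  have hA : finrank F V - finrank F A = finrank F A.dualAnnihilator := by
    have := Subspace.finrank_add_finrank_dualAnnihilator_eq A
    omega
  rw [hA, ← ncard_finrank_eq_one_le, ← Set.ncard_image_of_injective _
    (Subspace.orderIsoFiniteDimensional (K := F) (V := V)).injective]
  apply congrArg Set.ncard
  ext L
  constructor
  · rintro ⟨W, ⟨hAW, hW⟩, rfl⟩
    refine ⟨Submodule.dualAnnihilator_anti hAW, ?_⟩
    change finrank F W.dualAnnihilator = 1
    have := Subspace.finrank_add_finrank_dualAnnihilator_eq W
    omega
  · rintro ⟨hLA, hL⟩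
    refine ⟨L.dualCoannihilator, ⟨?_, ?_⟩,
      (Subspace.orderIsoFiniteDimensional (K := F) (V := V)).right_inv L⟩
    · exact Submodule.le_dualAnnihilator_iff_le_dualCoannihilator.1 hLA
    · have := Subspace.finrank_add_finrank_dualCoannihilator_eq L
      omega

/-- The number of hyperplanes of `S` containing a given subspace of `S`. -/
theorem ncard_hyperplanes_ge_le [Finite F] [FiniteDimensional F V] {A S : Submodule F V}
    (hAS : A ≤ S) :
    {W : Submodule F V | A ≤ W ∧ W ≤ S ∧ finrank F W + 1 = finrank F S}.ncard =
      ∑ i ∈ Finset.range (finrank F S - finrank F A), Nat.card F ^ i := by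
  have hA : finrank F A = finrank F (A.comap S.subtype) := by
    rw [← Submodule.finrank_map_subtype_eq, Submodule.map_comap_subtype, inf_eq_right.2 hAS]
  rw [hA, ← ncard_hyperplanes_ge, ← Set.ncard_image_of_injective _
    (Submodule.map_injective_of_injective S.subtype_injective)]
  apply congrArg Set.ncard
  ext W
  constructor
  · rintro ⟨hAW, hWS, hW⟩
    refine ⟨W.comap S.subtype, ⟨Submodule.comap_mono hAW, ?_⟩, ?_⟩
    · rw [← Submodule.finrank_map_subtype_eq, Submodule.map_comap_subtype,
        inf_eq_right.2 hWS, hW]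
    · rw [Submodule.map_comap_subtype, inf_eq_right.2 hWS]
  · rintro ⟨M, ⟨hAM, hM⟩, rfl⟩
    refine ⟨?_, Submodule.map_subtype_le _ _, by rwa [Submodule.finrank_map_subtype_eq]⟩
    rw [← inf_eq_right.2 hAS, ← Submodule.map_comap_subtype]
    exact Submodule.map_mono hAM

open Classical in
/-- The pairs `(u, v)` of linearly independent vectors with `u ∈ X` and `v ∈ Y`. -/
noncomputable def independentPairs [Fintype V] (X Y : Submodule F V) : Finset (V × V) :=
  {p | (p.1 ∈ X ∧ p.1 ≠ 0) ∧ p.2 ∈ Y ∧ p.2 ∉ Submodule.span F {p.1}}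

theorem mem_independentPairs [Fintype V] {X Y : Submodule F V} {p : V × V} :
    p ∈ independentPairs X Y ↔
      (p.1 ∈ X ∧ p.1 ≠ 0) ∧ p.2 ∈ Y ∧ p.2 ∉ Submodule.span F {p.1} := by
  simp [independentPairs]

theorem card_independentPairs [Fintype F] [Fintype V] {X Y : Submodule F V} (h : X ≤ Y) :
    ((independentPairs X Y).card : ℤ) =
      ((Fintype.card F : ℤ) ^ finrank F X - 1) *
        ((Fintype.card F : ℤ) ^ finrank F Y - Fintype.card F) := by
  classical
  have hcard (Z : Submodule F V) :
      ((Finset.univ.filter (· ∈ Z)).card : ℤ) = (Fintype.card F : ℤ) ^ finrank F Z := by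
    rw [← Fintype.card_subtype]
    exact_mod_cast Module.card_eq_pow_finrank (K := F) (V := Z)
  have hfst : ((Finset.univ.filter fun u => u ∈ X ∧ u ≠ 0).card : ℤ) =
      (Fintype.card F : ℤ) ^ finrank F X - 1 := by
    have : (Finset.univ.filter fun u => u ∈ X ∧ u ≠ 0) =
        (Finset.univ.filter (· ∈ X)) \ {0} := by
      ext; simp
    rw [this, Finset.cast_card_sdiff (by simp), hcard]
    simp
  have hsnd (u : V) (hu : u ∈ X) (hu0 : u ≠ 0) :
      ((Finset.univ.filter fun v => v ∈ Y ∧ v ∉ Submodule.span F {u}).card : ℤ) =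
      (Fintype.card F : ℤ) ^ finrank F Y - Fintype.card F := by
    have hs : (Finset.univ.filter fun v => v ∈ Y ∧ v ∉ Submodule.span F {u}) =
        (Finset.univ.filter (· ∈ Y)) \ (Finset.univ.filter (· ∈ Submodule.span F {u})) := by
      ext; simp
    have hle : Submodule.span F {u} ≤ Y := by
      simpa using h hu
    rw [hs, Finset.cast_card_sdiff, hcard, hcard, finrank_span_singleton hu0, pow_one]
    intro v hv
    simpa using hle (by simpa using hv)
  rw [← hfst, Finset.card_eq_sum_card_fiberwise (f := Prod.fst)
    (t := Finset.univ.filter fun u => u ∈ X ∧ u ≠ 0)]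
  · push_cast
    rw [Finset.sum_congr rfl (g := fun _ =>
      (Fintype.card F : ℤ) ^ finrank F Y - Fintype.card F), Finset.sum_const, nsmul_eq_mul]
    intro u hu
    rw [Finset.mem_filter] at hu
    rw [← hsnd u hu.2.1 hu.2.2]
    refine congrArg Nat.cast (Finset.card_nbij' Prod.snd (fun v => (u, v)) ?_ ?_ ?_ ?_)
    · rintro ⟨a, b⟩ hab
      simp only [Finset.coe_filter, Set.mem_ofPred_eq, mem_independentPairs] at hab
      obtain ⟨hab, rfl⟩ := hab
      simpa using hab.2
    · intro v hv
      simp only [Finset.coe_filter, Set.mem_ofPred_eq, Finset.mem_univ, true_and] at hv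
      simp [mem_independentPairs, hu.2.1, hu.2.2, hv]
    · rintro ⟨a, b⟩ hab
      simp only [Finset.coe_filter, Set.mem_ofPred_eq] at hab
      simp [hab.2]
    · intro v _
      rfl
  · intro p hp
    simpa using (mem_independentPairs.1 hp).1

theorem finrank_span_pair_of_mem_independentPairs [Fintype V] {X Y : Submodule F V} {p : V × V}
    (hp : p ∈ independentPairs X Y) : finrank F (Submodule.span F {p.1, p.2}) = 2 := by
  obtain ⟨⟨-, h0⟩, -, hspan⟩ := mem_independentPairs.1 hp
  have hli : LinearIndependent F ![p.1, p.2] := by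
    rw [LinearIndependent.pair_iff' h0]
    exact fun a ha => hspan (Submodule.mem_span_singleton.2 ⟨a, ha⟩)
  have h := finrank_span_eq_card hli
  rwa [Matrix.range_cons_cons_empty, Fintype.card_fin] at h

end SubspaceCounting

namespace IsSubspaceDesign

variable {F V : Type*} [Field F] [AddCommGroup V] [Module F V] {t k : ℕ}
  {D : Set (Submodule F V)}

theorem existsUnique_block (hD : IsSubspaceDesign F t k 1 D) {T : Submodule F V}
    (hT : finrank F T = t) : ∃! B, B ∈ D ∧ T ≤ B := by
  obtain ⟨B, hB⟩ := Set.ncard_eq_one.1 (hD.2 T hT)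
  have hB' (C : Submodule F V) : C ∈ D ∧ T ≤ C ↔ C = B := by
    exact Set.ext_iff.1 hB C
  exact ⟨B, (hB' B).2 rfl, fun C hC => (hB' C).1 hC⟩

theorem eq_of_le_finrank_inf [FiniteDimensional F V] (hD : IsSubspaceDesign F t k 1 D)
    {B C : Submodule F V} (hB : B ∈ D) (hC : C ∈ D)
    (h : t ≤ finrank F ↥(B ⊓ C)) : B = C := by
  obtain ⟨f, hf⟩ := exists_linearIndependent_of_le_finrank h
  have hli : LinearIndependent F (fun i => (f i : V)) :=
    hf.map' (B ⊓ C).subtype (Submodule.ker_subtype _)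
  have hT : finrank F (Submodule.span F (Set.range fun i => (f i : V))) = t := by
    simpa using finrank_span_eq_card hli
  refine (hD.existsUnique_block hT).unique ⟨hB, ?_⟩ ⟨hC, ?_⟩
  · exact Submodule.span_le.2 (Set.range_subset_iff.2 fun i => (f i).2.1)
  · exact Submodule.span_le.2 (Set.range_subset_iff.2 fun i => (f i).2.2)

theorem card_independentPairs_eq_sum [Fintype V] {E : Finset (Submodule F V)}
    (hE : IsSubspaceDesign F 2 k 1 (E : Set (Submodule F V))) (X Y : Submodule F V) :
    (independentPairs X Y).card =
      ∑ B ∈ E, (independentPairs (B ⊓ X) (B ⊓ Y)).card := by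
  classical
  rw [← Finset.card_biUnion]
  · congr 1
    ext p
    rw [Finset.mem_biUnion]
    constructor
    · intro hp
      obtain ⟨B, ⟨hB, hle⟩, -⟩ :=
        hE.existsUnique_block (finrank_span_pair_of_mem_independentPairs hp)
      have h1 : p.1 ∈ B := hle (Submodule.subset_span (by simp))
      have h2 : p.2 ∈ B := hle (Submodule.subset_span (by simp))
      rw [mem_independentPairs] at hp
      exact ⟨B, hB, mem_independentPairs.2 ⟨⟨⟨h1, hp.1.1⟩, hp.1.2⟩, ⟨h2, hp.2.1⟩, hp.2.2⟩⟩
    · rintro ⟨B, -, hp⟩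
      rw [mem_independentPairs] at hp ⊢
      exact ⟨⟨hp.1.1.2, hp.1.2⟩, hp.2.1.2, hp.2.2⟩
  · intro B hB C hC hne
    refine Finset.disjoint_left.2 fun p hpB hpC => hne ?_
    have h2 := finrank_span_pair_of_mem_independentPairs hpB
    rw [mem_independentPairs] at hpB hpC
    refine (hE.existsUnique_block h2).unique ⟨hB, ?_⟩ ⟨hC, ?_⟩
    · exact Submodule.span_le.2 (by
        simpa [Set.insert_subset_iff] using ⟨hpB.1.1.1, hpB.2.1.1⟩)
    · exact Submodule.span_le.2 (by
        simpa [Set.insert_subset_iff] using ⟨hpC.1.1.1, hpC.2.1.1⟩)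

open Classical in
/-- In a `2-(7,3,1)_q` design, every 5-dimensional subspace contains `q ^ 2 + 1` blocks. -/
theorem card_blocks_le_dim_five [Fintype F] [Fintype V] (hV : finrank F V = 7)
    {E : Finset (Submodule F V)} (hE : IsSubspaceDesign F 2 3 1 (E : Set (Submodule F V)))
    {S : Submodule F V} (hS : finrank F S = 5) :
    (E.filter (· ≤ S)).card = Fintype.card F ^ 2 + 1 := by
  set q : ℤ := (Fintype.card F : ℤ) with hq
  have hq1 : 1 < q := by
    rw [hq]
    exact_mod_cast Fintype.one_lt_card (α := F)
  set s : Submodule F V → ℤ := fun B => q ^ finrank F ↥(B ⊓ S)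
  have hVV : (q ^ 7 - 1) * (q ^ 7 - q) = ∑ B ∈ E, (q ^ 3 - 1) * (q ^ 3 - q) := by
    have h := hE.card_independentPairs_eq_sum ⊤ ⊤
    zify at h
    rw [card_independentPairs le_rfl, finrank_top, hV] at h
    rw [h]
    refine Finset.sum_congr rfl fun B hB => ?_
    rw [card_independentPairs le_rfl, inf_top_eq, hE.1 B hB]
  have hSV : (q ^ 5 - 1) * (q ^ 7 - q) = ∑ B ∈ E, (s B - 1) * (q ^ 3 - q) := by
    have h := hE.card_independentPairs_eq_sum S ⊤
    zify at h
    rw [card_independentPairs le_top, finrank_top, hV, hS] at h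
    rw [h]
    refine Finset.sum_congr rfl fun B hB => ?_
    rw [card_independentPairs (inf_le_inf_left _ le_top), inf_top_eq, hE.1 B hB]
  have hSS : (q ^ 5 - 1) * (q ^ 5 - q) = ∑ B ∈ E, (s B - 1) * (s B - q) := by
    have h := hE.card_independentPairs_eq_sum S S
    zify at h
    rw [card_independentPairs le_rfl, hS] at h
    rw [h]
    exact Finset.sum_congr rfl fun B hB => card_independentPairs le_rfl
  have hsum : ∑ B ∈ E, (s B - q) * (s B - q ^ 2) =
      ((E.filter (· ≤ S)).card : ℤ) * ((q ^ 3 - q) * (q ^ 3 - q ^ 2)) := by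
    rw [Finset.card_filter]
    push_cast
    rw [Finset.sum_mul]
    refine Finset.sum_congr rfl fun B hB => ?_
    have hB3 := hE.1 B hB
    split_ifs with hBS
    · have hs : s B = q ^ 3 := by
        change q ^ finrank F ↥(B ⊓ S) = q ^ 3
        rw [inf_eq_left.2 hBS, hB3]
      rw [hs, one_mul]
    · have hlt : finrank F ↥(B ⊓ S) < 3 := by
        rw [← hB3]
        exact Submodule.finrank_lt_finrank_of_lt (inf_lt_left.2 hBS)
      have hpos : 1 ≤ finrank F ↥(B ⊓ S) := by
        have h1 := Submodule.finrank_sup_add_finrank_inf_eq B S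
        have h2 := Submodule.finrank_le (B ⊔ S)
        omega
      have h12 : finrank F ↥(B ⊓ S) = 1 ∨ finrank F ↥(B ⊓ S) = 2 := by omega
      rcases h12 with h | h <;> simp [s, h]
  have hexpand : (∑ B ∈ E, (s B - q) * (s B - q ^ 2)) * ((q ^ 3 - 1) * (q ^ 3 - q)) =
      (q ^ 3 - 1) * (q ^ 3 - q) * ∑ B ∈ E, (s B - 1) * (s B - q)
      + (1 - q ^ 2) * (q ^ 3 - 1) * ∑ B ∈ E, (s B - 1) * (q ^ 3 - q)
      + (1 - q ^ 2) * (1 - q) * ∑ B ∈ E, (q ^ 3 - 1) * (q ^ 3 - q) := by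
    rw [Finset.sum_mul, Finset.mul_sum, Finset.mul_sum, Finset.mul_sum,
      ← Finset.sum_add_distrib, ← Finset.sum_add_distrib]
    exact Finset.sum_congr rfl fun B _ => by ring
  rw [← hVV, ← hSV, ← hSS, hsum] at hexpand
  have hpow {m n : ℕ} (h : m < n) : q ^ n - q ^ m ≠ 0 :=
    sub_ne_zero.2 (pow_lt_pow_right₀ hq1 h).ne'
  have h31 := hpow (m := 1) (n := 3) (by norm_num)
  have h32 := hpow (m := 2) (n := 3) (by norm_num)
  have h30 := hpow (m := 0) (n := 3) (by norm_num)
  rw [pow_one] at h31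
  rw [pow_zero] at h30
  have hne := mul_ne_zero (mul_ne_zero h31 h32) (mul_ne_zero h30 h31)
  have : ((E.filter (· ≤ S)).card : ℤ) = q ^ 2 + 1 := by
    apply mul_right_cancel₀ hne
    linear_combination hexpand
  rw [hq] at this
  exact_mod_cast this

end IsSubspaceDesign

/-- In a `2-(7,3,1)_q` subspace design on `V`, for every `5`-dimensional subspace
`S` of `V`, the number of `4`-dimensional subspaces of `S` containing a block is
`q³ + q² + q + 1`, and the number of `4`-dimensional subspaces of `S` containing
no block is `q⁴`. -/
theorem fano_dim4_type_counts_in_dim5 {q : ℕ} (hq : IsPrimePow q)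
    {F : Type*} [Field F] [Fintype F] (hF : Fintype.card F = q)
    {V : Type*} [AddCommGroup V] [Module F V] [FiniteDimensional F V]
    (hV : Module.finrank F V = 7)
    (D : Set (Submodule F V)) (hD : IsSubspaceDesign F 2 3 1 D)
    (S : Submodule F V) (hS : Module.finrank F S = 5) :
    {W : Submodule F V | W ≤ S ∧ Module.finrank F W = 4 ∧ ∃ B ∈ D, B ≤ W}.ncard =
        q ^ 3 + q ^ 2 + q + 1 ∧
      {W : Submodule F V |
          W ≤ S ∧ Module.finrank F W = 4 ∧ ¬ ∃ B ∈ D, B ≤ W}.ncard = q ^ 4 := by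
  classical
  subst hF
  have : Finite V := Module.finite_of_finite F
  have := Fintype.ofFinite V
  obtain ⟨E, rfl⟩ := (Set.toFinite D).exists_finset_coe
  set H : Finset (Submodule F V) := {W | W ≤ S ∧ finrank F W = 4} with hH
  have hdim (W : Submodule F V) : finrank F W + 1 = finrank F S ↔ finrank F W = 4 := by omega
  have hcard (B : Submodule F V) (hBS : B ≤ S) : (H.filter (B ≤ ·)).card =
      ∑ i ∈ Finset.range (5 - finrank F B), Fintype.card F ^ i := by
    have h := ncard_hyperplanes_ge_le hBS
    rw [hS, Nat.card_eq_fintype_card] at h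
    rw [← h, ← Set.ncard_coe_finset]
    congr 1
    ext W
    simp only [hH, Finset.coe_filter, Finset.mem_filter_univ, Set.mem_ofPred_eq]
    constructor
    · rintro ⟨⟨h1, h2⟩, h3⟩
      exact ⟨h3, h1, by omega⟩
    · rintro ⟨h1, h2, h3⟩
      exact ⟨⟨h2, by omega⟩, h1⟩
  have htotal : H.card = ∑ i ∈ Finset.range 5, Fintype.card F ^ i := by
    simpa using hcard ⊥ bot_le
  have hwith : (H.filter fun W => ∃ B ∈ E, B ≤ W).card =
      (Fintype.card F ^ 2 + 1) * (Fintype.card F + 1) := by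
    have hunion : (H.filter fun W => ∃ B ∈ E, B ≤ W) =
        (E.filter (· ≤ S)).biUnion fun B => H.filter (B ≤ ·) := by
      ext W
      simp only [Finset.mem_filter, Finset.mem_biUnion]
      constructor
      · rintro ⟨hW, B, hB, hBW⟩
        exact ⟨B, ⟨hB, hBW.trans (Finset.mem_filter.1 hW).2.1⟩, hW, hBW⟩
      · rintro ⟨B, ⟨hB, -⟩, hW, hBW⟩
        exact ⟨hW, B, hB, hBW⟩
    rw [hunion, Finset.card_biUnion, ← hD.card_blocks_le_dim_five hV hS]
    · refine Finset.sum_const_nat fun B hB => ?_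
      rw [Finset.mem_filter] at hB
      rw [hcard B hB.2, hD.1 B hB.1]
      simp [Finset.sum_range_succ, add_comm]
    · intro B hB C hC hne
      refine Finset.disjoint_left.2 fun W hWB hWC => hne ?_
      simp only [hH, Finset.coe_filter, Set.mem_ofPred_eq, Finset.mem_filter, Finset.mem_univ,
        true_and] at hB hC hWB hWC
      refine hD.eq_of_le_finrank_inf hB.1 hC.1 ?_
      have h1 := Submodule.finrank_sup_add_finrank_inf_eq B C
      have h2 := Submodule.finrank_mono (sup_le hWB.2 hWC.2)
      have h3 := hD.1 B hB.1
      have h4 := hD.1 C hC.1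
      omega
  have hsplit := Finset.card_filter_add_card_filter_not (s := H) (fun W => ∃ B ∈ E, B ≤ W)
  have hset (P : Submodule F V → Prop) [DecidablePred P] :
      {W : Submodule F V | W ≤ S ∧ finrank F W = 4 ∧ P W}.ncard = (H.filter P).card := by
    rw [← Set.ncard_coe_finset]
    congr 1
    ext W
    simp [hH, and_assoc]
  have h1 : (H.filter fun W => ∃ B ∈ E, B ≤ W).card =
      Fintype.card F ^ 3 + Fintype.card F ^ 2 + Fintype.card F + 1 := by
    rw [hwith]
    ring
  simp only [Finset.mem_coe, hset]
  refine ⟨h1, ?_⟩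
  simp only [Finset.sum_range_succ, Finset.sum_range_zero, pow_zero, pow_one] at htotal
  omega
end

section
/- Let q be a prime power, V a 7-dimensional vector space over 𝔽_q, and D a 2-(7,3,1)_q subspace design on V. Let S be a 3-dimensional subspace of V. If S ∈ D, then (α_0(S), α_1(S), α_2(S), α_3(S)) = (q⁴(q² + 1)(q + 1)(q − 1), q²(q² + q + 1)(q² + 1), 0, 1); if S ∉ D, then (α_0(S), α_1(S), α_2(S), α_3(S)) = (q³(q⁵ − q + 1), q(q³ + q − 1)(q² + q + 1), q² + q + 1, 0). -/
open Finset Module in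
/-- The number of linearly independent pairs `(v, w)` with `v ∈ S` and `w ∈ T`, where `S ≤ T`. -/
theorem card_filter_independent_pairs {F V : Type*} [Field F] [Fintype F] [AddCommGroup V]
    [Module F V] [Fintype V] {S T : Submodule F V} (hST : S ≤ T)
    [DecidablePred fun p : V × V =>
      (p.1 ∈ S ∧ p.2 ∈ T) ∧ p.1 ≠ 0 ∧ p.2 ∉ Submodule.span F {p.1}] :
    #{p : V × V | (p.1 ∈ S ∧ p.2 ∈ T) ∧ p.1 ≠ 0 ∧ p.2 ∉ Submodule.span F {p.1}} =
      (Fintype.card F ^ finrank F S - 1) * (Fintype.card F ^ finrank F T - Fintype.card F) := by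
  classical
  have card_mem (U : Submodule F V) : #{v | v ∈ U} = Fintype.card F ^ finrank F U := by
    rw [← card_eq_pow_finrank (K := F) (V := U), Fintype.card_subtype]
  have fiber (v : V) (hv : v ∈ ({v | v ∈ S} : Finset V).erase 0) :
      #{w | w ∈ T ∧ w ∉ Submodule.span F {v}} =
        Fintype.card F ^ finrank F T - Fintype.card F := by
    simp only [mem_erase, mem_filter_univ] at hv
    have hle : Submodule.span F {v} ≤ T := by
      simpa [Submodule.span_le] using hST hv.2
    have h := card_mem (Submodule.span F {v})
    rw [finrank_span_singleton hv.1, pow_one] at h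
    rw [← card_mem T, ← h, ← card_sdiff_of_subset
      (fun w hw => by simp only [mem_filter_univ] at hw ⊢; exact hle hw)]
    congr 1
    ext w
    simp
  calc
    _ = #((({v | v ∈ S} : Finset V).erase 0).sigma
          fun v => {w | w ∈ T ∧ w ∉ Submodule.span F {v}}) := by
      refine card_bij (fun p _ => ⟨p.1, p.2⟩) ?_ ?_ ?_
      · simp +contextual
      · rintro ⟨a, b⟩ _ ⟨c, d⟩ _ h
        simpa using h
      · rintro ⟨a, b⟩ h
        refine ⟨(a, b), ?_, rfl⟩
        simp only [mem_sigma, mem_erase, mem_filter_univ] at h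
        rw [mem_filter_univ]
        exact ⟨⟨h.1.2, h.2.1⟩, h.1.1, h.2.2⟩
    _ = _ := by
      rw [card_sigma, sum_congr rfl fiber, sum_const, smul_eq_mul, card_erase_of_mem (by simp),
        card_mem]

namespace IsSubspaceDesign

open Finset Module

variable {F V : Type*} [Field F] [AddCommGroup V] [Module F V]
  [FiniteDimensional F V] {k : ℕ} {D : Set (Submodule F V)}

/-- Counting the linearly independent pairs in `S × T`, where `S ≤ T`, by the unique block of a
design with `t = 2` and `λ = 1` that contains them. -/
theorem sum_independent_pairs [Fintype F] [Fintype (Submodule F V)] [DecidablePred (· ∈ D)]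
    (hD : IsSubspaceDesign F 2 k 1 D) {S T : Submodule F V} (hST : S ≤ T) :
    ∑ B with B ∈ D, (Fintype.card F ^ finrank F ↥(B ⊓ S) - 1) *
        (Fintype.card F ^ finrank F ↥(B ⊓ T) - Fintype.card F) =
      (Fintype.card F ^ finrank F S - 1) * (Fintype.card F ^ finrank F T - Fintype.card F) := by
  classical
  have : Finite V := Module.finite_of_finite F
  have : Fintype V := Fintype.ofFinite V
  set P : Finset (V × V) :=
    {p : V × V | (p.1 ∈ S ∧ p.2 ∈ T) ∧ p.1 ≠ 0 ∧ p.2 ∉ Submodule.span F {p.1}} with hP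
  have key := sum_card_bipartiteAbove_eq_sum_card_bipartiteBelow (s := {B | B ∈ D}) (t := P)
    (fun (B : Submodule F V) (p : V × V) => p.1 ∈ B ∧ p.2 ∈ B)
  rw [← card_filter_independent_pairs hST, ← hP, card_eq_sum_ones]
  refine Eq.trans (sum_congr rfl fun B _ => ?_) (key.trans (sum_congr rfl fun p hp => ?_))
  · rw [← card_filter_independent_pairs (inf_le_inf_left B hST)]
    congr 1
    ext p
    simp only [hP, bipartiteAbove, mem_filter, mem_univ, true_and, Submodule.mem_inf]
    tauto
  · rw [hP, mem_filter_univ] at hp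
    have hli : LinearIndependent F ![p.1, p.2] := by
      rw [LinearIndependent.pair_iff' hp.2.1]
      exact fun a ha => hp.2.2 (Submodule.mem_span_singleton.2 ⟨a, ha⟩)
    have hspan := hD.2 (Submodule.span F (Set.range ![p.1, p.2]))
      ((finrank_span_eq_card hli).trans (Fintype.card_fin 2))
    rw [← hspan, ← Set.ncard_coe_finset]
    congr 1
    ext B
    simp [bipartiteBelow, Submodule.span_le, Set.insert_subset_iff]
    tauto

/-- Sums over the blocks of a function of the dimension of the intersection with `S`, in terms of
the intersection numbers of `S`. -/
theorem sum_eq_sum_interNum [Fintype (Submodule F V)] [DecidablePred (· ∈ D)] {t lam : ℕ}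
    (hD : IsSubspaceDesign F t k lam D) (S : Submodule F V) (f : ℕ → ℕ) :
    ∑ B with B ∈ D, f (finrank F ↥(B ⊓ S)) = ∑ i ∈ range (k + 1), interNum D S i * f i := by
  classical
  rw [← sum_fiberwise_of_maps_to (t := range (k + 1)) (g := fun B => finrank F ↥(B ⊓ S))]
  · refine sum_congr rfl fun i _ => ?_
    rw [sum_congr rfl (g := fun _ => f i) fun B hB => by rw [(mem_filter.1 hB).2], sum_const,
      smul_eq_mul, interNum, ← Set.ncard_coe_finset]
    congr 2
    ext B
    simp
  · intro B hB
    rw [mem_range, Nat.lt_succ_iff, ← hD.1 B (mem_filter.1 hB).2]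
    exact Submodule.finrank_mono inf_le_left

/-- A `k`-dimensional subspace meets only itself, among the blocks, in dimension `k`. -/
theorem interNum_self_dim {t lam : ℕ} (hD : IsSubspaceDesign F t k lam D)
    {S : Submodule F V} [Decidable (S ∈ D)] (hS : finrank F S = k) :
    interNum D S k = if S ∈ D then 1 else 0 := by
  have h : {B ∈ D | finrank F ↥(B ⊓ S) = k} = {B ∈ D | B = S} := by
    ext B
    refine and_congr_right fun hB => ⟨fun h => ?_, fun h => by rw [h, inf_idem, hS]⟩
    have hBk := hD.1 B hB
    rw [← Submodule.eq_of_le_of_finrank_eq (inf_le_left : B ⊓ S ≤ B) (h.trans hBk.symm)]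
    exact Submodule.eq_of_le_of_finrank_eq inf_le_right (h.trans hS.symm)
  rw [interNum, h]
  split_ifs with hSD
  · rw [Set.ncard_eq_one]
    exact ⟨S, by ext B; simp +contextual [hSD]⟩
  · convert Set.ncard_empty (Submodule F V)
    ext B
    simp only [Set.mem_ofPred_eq, Set.mem_empty_iff_false, iff_false]
    rintro ⟨hB, rfl⟩
    exact hSD hB

end IsSubspaceDesign

/-- In a `2-(7,3,1)_q` subspace design, a `3`-dimensional subspace `S` has
intersection vector
`(q⁴(q²+1)(q+1)(q−1), q²(q²+q+1)(q²+1), 0, 1)` if `S` is a block, and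
`(q³(q⁵−q+1), q(q³+q−1)(q²+q+1), q²+q+1, 0)` otherwise. -/
theorem fano_interNum_dim3 {q : ℕ} (hq : IsPrimePow q)
    {F : Type*} [Field F] [Fintype F] (hF : Fintype.card F = q)
    {V : Type*} [AddCommGroup V] [Module F V] [FiniteDimensional F V]
    (hV : Module.finrank F V = 7)
    (D : Set (Submodule F V)) (hD : IsSubspaceDesign F 2 3 1 D)
    (S : Submodule F V) (hS : Module.finrank F S = 3) :
    (S ∈ D →
      interNum D S 0 = q ^ 4 * (q ^ 2 + 1) * (q + 1) * (q - 1) ∧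
      interNum D S 1 = q ^ 2 * (q ^ 2 + q + 1) * (q ^ 2 + 1) ∧
      interNum D S 2 = 0 ∧
      interNum D S 3 = 1) ∧
    (S ∉ D →
      interNum D S 0 = q ^ 3 * (q ^ 5 - q + 1) ∧
      interNum D S 1 = q * (q ^ 3 + q - 1) * (q ^ 2 + q + 1) ∧
      interNum D S 2 = q ^ 2 + q + 1 ∧
      interNum D S 3 = 0) := by
  classical
  have : Finite V := Module.finite_of_finite F
  have : Fintype (Submodule F V) := Fintype.ofFinite _
  have hq2 : 2 ≤ q := hq.two_le
  have hblock (B : Submodule F V) (hB : B ∈ Finset.univ.filter (· ∈ D)) :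
      Module.finrank F B = 3 := hD.1 B (Finset.mem_filter.1 hB).2
  have hSS := hD.sum_independent_pairs (le_refl S)
  rw [hD.sum_eq_sum_interNum S
    (fun i => (Fintype.card F ^ i - 1) * (Fintype.card F ^ i - Fintype.card F)), hF, hS] at hSS
  have hSV := hD.sum_independent_pairs (le_top : S ≤ ⊤)
  rw [Finset.sum_congr rfl (fun B hB => by rw [inf_top_eq, hblock B hB]),
    hD.sum_eq_sum_interNum S
      (fun i => (Fintype.card F ^ i - 1) * (Fintype.card F ^ 3 - Fintype.card F)),
    hF, hS, finrank_top, hV] at hSV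
  have hVV := hD.sum_independent_pairs (le_refl (⊤ : Submodule F V))
  rw [Finset.sum_congr rfl (fun B hB => by rw [inf_top_eq, hblock B hB]),
    hD.sum_eq_sum_interNum S
      (fun _ => (Fintype.card F ^ 3 - 1) * (Fintype.card F ^ 3 - Fintype.card F)),
    hF, finrank_top, hV] at hVV
  have h3 := hD.interNum_self_dim hS
  simp only [Finset.sum_range_succ, Finset.sum_range_zero, pow_zero, pow_one, Nat.sub_self,
    zero_mul, mul_zero, zero_add] at hSS hSV hVV
  generalize interNum D S 0 = a0 at *
  generalize interNum D S 1 = a1 at *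
  generalize interNum D S 2 = a2 at *
  generalize interNum D S 3 = a3 at *
  have le_pow (i : ℕ) (hi : i ≠ 0) : q ≤ q ^ i := Nat.le_self_pow hi q
  have one_le_pow (i : ℕ) : 1 ≤ q ^ i := Nat.one_le_pow _ _ (by omega)
  have h5 : q ≤ q ^ 5 := le_pow 5 (by norm_num)
  have h1 : 1 ≤ q := by omega
  have h1' : 1 ≤ q ^ 3 + q := by omega
  zify [le_pow 2 (by norm_num), le_pow 3 (by norm_num), le_pow 7 (by norm_num), one_le_pow 2,
    one_le_pow 3, one_le_pow 7, h1, h1', h5] at hSS hSV hVV ⊢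
  have hq1 : (q : ℤ) - 1 ≠ 0 := by omega
  have hq0 : (q : ℤ) ≠ 0 := by omega
  have hq1' : (q : ℤ) + 1 ≠ 0 := by omega
  have hq3 : (q : ℤ) ^ 2 + q + 1 ≠ 0 := by positivity
  have cancel2 : (q : ℤ) * (q - 1) ^ 2 * (q + 1) ≠ 0 := by positivity
  have cancel0 : (q : ℤ) * (q - 1) ^ 2 * (q + 1) * (q ^ 2 + q + 1) ≠ 0 := by positivity
  refine ⟨fun hSD => ?_, fun hSD => ?_⟩
  · rw [if_pos hSD] at h3
    subst h3
    push_cast at hSS hSV hVV ⊢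
    have e2 : (a2 : ℤ) = 0 := mul_left_cancel₀ cancel2 (by linear_combination hSS)
    rw [e2] at hSV hVV
    have e1 : (a1 : ℤ) = q ^ 2 * (q ^ 2 + q + 1) * (q ^ 2 + 1) :=
      mul_left_cancel₀ cancel2 (by linear_combination hSV)
    rw [e1] at hVV
    exact ⟨mul_left_cancel₀ cancel0 (by linear_combination hVV), e1, e2, trivial⟩
  · rw [if_neg hSD] at h3
    subst h3
    push_cast at hSS hSV hVV ⊢
    have e2 : (a2 : ℤ) = q ^ 2 + q + 1 := mul_left_cancel₀ cancel2 (by linear_combination hSS)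
    rw [e2] at hSV hVV
    have e1 : (a1 : ℤ) = q * (q ^ 3 + q - 1) * (q ^ 2 + q + 1) :=
      mul_left_cancel₀ cancel2 (by linear_combination hSV)
    rw [e1] at hVV
    exact ⟨mul_left_cancel₀ cancel0 (by linear_combination hVV), e1, e2, trivial⟩
end
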